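/- Let k, m ∈ ℕ and let α ∈ (k−1, k) be a non-integer real with α + m > 1/2. There exists a constant C > 0, depending only on α and m, such that for every integer p with α + m < p + 1 and every ω ∈ 𝒰^{α,m}_{−1+}((−1,1)), the Gauss–Radau projection Π_p^+ ω satisfies ‖ω − Π_p^+ ω‖_{L²(−1,1)} ≤ C · p^{−min{2α+1/2, α+m−1/2}} · U^{α,m}_{−1+}(ω;(−1,1)). -/

import Mathlib

open MeasureTheory Set Filter

/-- The left Caputo fractional derivative of order `α ∈ (k−1,k)` based at `a`:
`(^C D^α_{a+} u)(x) = (1/Γ(k−α)) ∫_a^x (x−y)^{k−α−1} u^{(k)}(y) dy`. -/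
noncomputable def caputoL (k : ℕ) (α a : ℝ) (u : ℝ → ℝ) (x : ℝ) : ℝ :=
  (1 / Real.Gamma ((k : ℝ) - α)) *
    ∫ y in a..x, (x - y) ^ ((k : ℝ) - α - 1) * iteratedDeriv k u y

/-- Membership `ω ∈ 𝒰^{α,m}_{−1+}((−1,1))`: `ω ∈ W^{k,1}(−1,1)` and
`^C D^α_{−1+} ω ∈ W^{m,1}(−1,1)`, with `L i` the (finite) right-hand limits
`D^i(^C D^α_{−1+} ω)(−1+)` for `i < m`. -/
def MemUL (k m : ℕ) (α : ℝ) (ω : ℝ → ℝ) (L : ℕ → ℝ) : Prop :=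
  ContinuousOn ω (Icc (-1 : ℝ) 1) ∧
  (∀ i < k, ∀ x ∈ Ioo (-1 : ℝ) 1,
      HasDerivAt (iteratedDeriv i ω) (iteratedDeriv (i + 1) ω x) x) ∧
  (∀ i ≤ k, IntervalIntegrable (iteratedDeriv i ω) volume (-1) 1) ∧
  (∀ i < m, ∀ x ∈ Ioo (-1 : ℝ) 1,
      HasDerivAt (iteratedDeriv i (caputoL k α (-1) ω))
        (iteratedDeriv (i + 1) (caputoL k α (-1) ω) x) x) ∧
  (∀ i ≤ m, IntervalIntegrable (iteratedDeriv i (caputoL k α (-1) ω)) volume (-1) 1) ∧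
  (∀ i < m, Tendsto (iteratedDeriv i (caputoL k α (-1) ω))
      (nhdsWithin (-1 : ℝ) (Ioi (-1))) (nhds (L i)))

/-- The semi-norm `U^{α,m}_{−1+}(ω;(−1,1))`. -/
noncomputable def UsemiL (k m : ℕ) (α : ℝ) (ω : ℝ → ℝ) (L : ℕ → ℝ) : ℝ :=
  (∫ x in (-1 : ℝ)..1, |iteratedDeriv m (caputoL k α (-1) ω) x|) +
    ∑ i ∈ Finset.range m, |L i|

open Polynomial in
/-- The Legendre polynomials, normalised by the value `1` at `1`. -/
noncomputable def legendreP : ℕ → ℝ[X]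
  | 0 => 1
  | 1 => X
  | n + 2 => C (((n : ℝ) + 2)⁻¹) *
      (C (2 * (n : ℝ) + 3) * X * legendreP (n + 1) - C ((n : ℝ) + 1) * legendreP n)

section LegendreAlgebra

open Polynomial

lemma legendreP_zero : legendreP 0 = 1 := by rw [legendreP]

lemma legendreP_one : legendreP 1 = X := by rw [legendreP]

lemma legendreP_recurrence (n : ℕ) :
    ((n : ℝ[X]) + 2) * legendreP (n + 2) =
      (2 * (n : ℝ[X]) + 3) * X * legendreP (n + 1) - ((n : ℝ[X]) + 1) * legendreP n := by
  rw [legendreP]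
  have h : ((n : ℝ[X]) + 2) * C (((n : ℝ) + 2)⁻¹) = 1 := by
    have : ((n : ℝ[X]) + 2) = C ((n : ℝ) + 2) := by simp [map_ofNat C]
    rw [this, ← C_mul, mul_inv_cancel₀ (by positivity), C_1]
  rw [← mul_assoc, h]
  simp [map_ofNat C]

lemma natCast_add_two_ne_zero (n : ℕ) : ((n : ℝ[X]) + 2) ≠ 0 := by
  have : ((n + 2 : ℕ) : ℝ[X]) ≠ 0 := Nat.cast_ne_zero.mpr (by omega)
  simpa using this

lemma derivative_legendreP_aux (n : ℕ) :
    derivative (legendreP (n + 1)) =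
        X * derivative (legendreP n) + ((n : ℝ[X]) + 1) * legendreP n ∧
      X * derivative (legendreP (n + 1)) - derivative (legendreP n) =
        ((n : ℝ[X]) + 1) * legendreP (n + 1) := by
  induction n with
  | zero => simp [legendreP_zero, legendreP_one]
  | succ n ih =>
    obtain ⟨h1, h2⟩ := ih
    have hr := legendreP_recurrence n
    have hd := congrArg derivative hr
    simp only [derivative_mul, derivative_sub, derivative_add, derivative_natCast, derivative_X,
      derivative_ofNat, derivative_one] at hd
    have e1 : derivative (legendreP (n + 1 + 1)) =
        X * derivative (legendreP (n + 1)) + (((n + 1 : ℕ) : ℝ[X]) + 1) * legendreP (n + 1) := by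
      apply mul_left_cancel₀ (natCast_add_two_ne_zero n)
      push_cast
      linear_combination hd + ((n : ℝ[X]) + 1) * h2
    refine ⟨e1, ?_⟩
    apply mul_left_cancel₀ (natCast_add_two_ne_zero n)
    rw [e1]
    push_cast
    linear_combination ((n:ℝ[X])+2) * X * h2 - ((n:ℝ[X])+2) * h1 - ((n:ℝ[X])+2) * hr

lemma derivative_legendreP_succ (n : ℕ) :
    derivative (legendreP (n + 1)) =
        X * derivative (legendreP n) + ((n : ℝ[X]) + 1) * legendreP n :=
  (derivative_legendreP_aux n).1

lemma X_mul_derivative_legendreP_succ (n : ℕ) :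
    X * derivative (legendreP (n + 1)) - derivative (legendreP n) =
        ((n : ℝ[X]) + 1) * legendreP (n + 1) :=
  (derivative_legendreP_aux n).2

lemma one_sub_X_sq_mul_derivative_legendreP (n : ℕ) :
    (1 - X ^ 2) * derivative (legendreP (n + 1)) =
      ((n : ℝ[X]) + 1) * (legendreP n - X * legendreP (n + 1)) := by
  linear_combination derivative_legendreP_succ n - X * X_mul_derivative_legendreP_succ n

lemma derivative_one_sub_X_sq_mul_derivative_legendreP (n : ℕ) :
    derivative ((1 - X ^ 2) * derivative (legendreP n)) =
      -((n : ℝ[X]) * ((n : ℝ[X]) + 1)) * legendreP n := by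
  cases n with
  | zero => simp [legendreP_zero]
  | succ n =>
    rw [one_sub_X_sq_mul_derivative_legendreP]
    simp only [derivative_mul, derivative_sub, derivative_add, derivative_natCast, derivative_X,
      derivative_one]
    push_cast
    linear_combination -((n : ℝ[X]) + 1) * X_mul_derivative_legendreP_succ n

lemma legendreP_eval_one (n : ℕ) : (legendreP n).eval 1 = 1 := by
  induction n using Nat.twoStepInduction with
  | zero => simp [legendreP_zero]
  | one => simp [legendreP_one]
  | more n h1 h2 =>
    have h := congrArg (eval 1) (legendreP_recurrence n)
    simp only [eval_mul, eval_sub, eval_add, eval_natCast, eval_ofNat, eval_X, eval_one, h1,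
      h2] at h
    have h0 : ((n : ℝ) + 2) ≠ 0 := by positivity
    apply mul_left_cancel₀ h0
    linarith

lemma legendreP_eval_neg (n : ℕ) (x : ℝ) :
    (legendreP n).eval (-x) = (-1) ^ n * (legendreP n).eval x := by
  induction n using Nat.twoStepInduction with
  | zero => simp [legendreP_zero]
  | one => simp [legendreP_one]
  | more n h1 h2 =>
    have h := congrArg (eval (-x)) (legendreP_recurrence n)
    have h' := congrArg (eval x) (legendreP_recurrence n)
    simp only [eval_mul, eval_sub, eval_add, eval_natCast, eval_ofNat, eval_X, eval_one] at h h'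
    have h0 : ((n : ℝ) + 2) ≠ 0 := by positivity
    apply mul_left_cancel₀ h0
    rw [h, h1, h2]
    linear_combination -(-1) ^ n * h'

lemma legendreP_eval_neg_one (n : ℕ) : (legendreP n).eval (-1) = (-1) ^ n := by
  rw [legendreP_eval_neg, legendreP_eval_one, mul_one]

lemma natDegree_legendreP_le (n : ℕ) : (legendreP n).natDegree ≤ n := by
  induction n using Nat.twoStepInduction with
  | zero => simp [legendreP_zero]
  | one => simp [legendreP_one]
  | more n h1 h2 =>
    rw [legendreP]
    refine (natDegree_C_mul_le _ _).trans ((natDegree_sub_le _ _).trans (max_le ?_ ?_))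
    · rw [mul_assoc]
      refine (natDegree_C_mul_le _ _).trans (natDegree_mul_le.trans ?_)
      have := natDegree_X_le (R := ℝ)
      omega
    · refine (natDegree_C_mul_le _ _).trans ?_
      omega

/-- Antiderivatives of `(2 n + 1) P_n` vanishing at `1`. -/
noncomputable def legendreD : ℕ → ℝ[X]
  | 0 => X - 1
  | n + 1 => legendreP (n + 2) - legendreP n

lemma derivative_legendreD (n : ℕ) :
    derivative (legendreD n) = (2 * (n : ℝ[X]) + 1) * legendreP n := by
  cases n with
  | zero => simp [legendreD, legendreP_zero]
  | succ n =>
    simp only [legendreD, derivative_sub]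
    have h1 := derivative_legendreP_succ (n + 1)
    have h2 := X_mul_derivative_legendreP_succ n
    push_cast at h1 ⊢
    linear_combination h1 + h2

lemma legendreD_eval_one (n : ℕ) : (legendreD n).eval 1 = 0 := by
  cases n <;> simp [legendreD, legendreP_eval_one]

lemma legendreD_succ_eval_neg_one (n : ℕ) : (legendreD (n + 1)).eval (-1) = 0 := by
  simp [legendreD, legendreP_eval_neg_one, pow_add]

lemma legendreP_eval_zero_sq_le (n : ℕ) : ((legendreP n).eval 0) ^ 2 ≤ 1 / ((n : ℝ) + 1) := by
  induction n using Nat.twoStepInduction with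
  | zero => simp [legendreP_zero]
  | one => simp only [legendreP_one, eval_X]; norm_num
  | more n h1 h2 =>
    have h := congrArg (eval 0) (legendreP_recurrence n)
    simp only [eval_mul, eval_sub, eval_add, eval_natCast, eval_ofNat, eval_X, eval_one] at h
    have e : (legendreP (n + 2)).eval 0 = -((n + 1) / (n + 2)) * (legendreP n).eval 0 := by
      have h0 : ((n : ℝ) + 2) ≠ 0 := by positivity
      field_simp
      linarith
    rw [e, mul_pow]
    calc (-((n + 1) / (n + 2) : ℝ)) ^ 2 * (legendreP n).eval 0 ^ 2
        ≤ (-((n + 1) / (n + 2) : ℝ)) ^ 2 * (1 / (n + 1)) := by gcongr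
      _ ≤ 1 / (((n + 2 : ℕ) : ℝ) + 1) := by
        push_cast
        rw [neg_sq, div_pow, div_mul_div_comm, div_le_div_iff₀ (by positivity) (by positivity)]
        have : (0 : ℝ) ≤ n := n.cast_nonneg
        nlinarith

/-- A polynomial whose derivative is `-x q` with `q ≥ 0` on `[-1,1]` is largest at `0`. -/
lemma eval_le_eval_zero_of_derivative {T q : ℝ[X]} (hT : derivative T = -X * q)
    (hq : ∀ x ∈ Icc (-1 : ℝ) 1, 0 ≤ q.eval x) {x : ℝ} (hx : x ∈ Icc (-1 : ℝ) 1) :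
    T.eval x ≤ T.eval 0 := by
  have hd : ∀ y, deriv (fun z => T.eval z) y = -y * q.eval y := fun y => by
    rw [Polynomial.deriv, hT]; simp
  rcases le_total 0 x with h | h
  · refine antitoneOn_of_deriv_nonpos (convex_Icc 0 1) T.continuous.continuousOn
      T.differentiable.differentiableOn (fun y hy => ?_) ⟨le_rfl, zero_le_one⟩ ⟨h, hx.2⟩ h
    rw [interior_Icc] at hy
    rw [hd]
    nlinarith [hq y ⟨by linarith [hy.1], hy.2.le⟩, hy.1]
  · refine monotoneOn_of_deriv_nonneg (convex_Icc (-1) 0) T.continuous.continuousOn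
      T.differentiable.differentiableOn (fun y hy => ?_) ⟨hx.1, h⟩ ⟨by norm_num, le_rfl⟩ h
    rw [interior_Icc] at hy
    rw [hd]
    nlinarith [hq y ⟨hy.1.le, by linarith [hy.2]⟩, hy.2]

/-- A polynomial whose derivative is `x q` with `q ≥ 0` on `[-1,1]` is largest at an endpoint. -/
lemma eval_le_of_derivative_eq_X_mul {T q : ℝ[X]} {A : ℝ} (hT : derivative T = X * q)
    (hq : ∀ x ∈ Icc (-1 : ℝ) 1, 0 ≤ q.eval x) (h1 : T.eval 1 ≤ A) (h2 : T.eval (-1) ≤ A)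
    {x : ℝ} (hx : x ∈ Icc (-1 : ℝ) 1) : T.eval x ≤ A := by
  have hd : ∀ y, deriv (fun z => T.eval z) y = y * q.eval y := fun y => by
    rw [Polynomial.deriv, hT]; simp
  rcases le_total 0 x with h | h
  · refine le_trans ?_ h1
    refine monotoneOn_of_deriv_nonneg (convex_Icc 0 1) T.continuous.continuousOn
      T.differentiable.differentiableOn (fun y hy => ?_) ⟨h, hx.2⟩ ⟨zero_le_one, le_rfl⟩ hx.2
    rw [interior_Icc] at hy
    rw [hd]
    nlinarith [hq y ⟨by linarith [hy.1], hy.2.le⟩, hy.1]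
  · refine le_trans ?_ h2
    refine antitoneOn_of_deriv_nonpos (convex_Icc (-1) 0) T.continuous.continuousOn
      T.differentiable.differentiableOn (fun y hy => ?_) ⟨le_rfl, by norm_num⟩ ⟨hx.1, h⟩ hx.1
    rw [interior_Icc] at hy
    rw [hd]
    nlinarith [hq y ⟨hy.1.le, by linarith [hy.2]⟩, hy.2]

lemma abs_legendreP_eval_le_one (n : ℕ) {x : ℝ} (hx : x ∈ Icc (-1 : ℝ) 1) :
    |(legendreP n).eval x| ≤ 1 := by
  rcases Nat.eq_zero_or_pos n with rfl | hn
  · simp [legendreP_zero]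
  set P := legendreP n with hP
  have hν : (0 : ℝ) < n * (n + 1) := by positivity
  let T : ℝ[X] := C ((n : ℝ) * (n + 1)) * P ^ 2 + (1 - X ^ 2) * derivative P ^ 2
  have hode := derivative_one_sub_X_sq_mul_derivative_legendreP n
  simp only [← hP, derivative_mul, derivative_sub, derivative_one, derivative_X_pow,
    Nat.cast_ofNat, zero_sub] at hode
  have hT : derivative T = X * (C 2 * derivative P ^ 2) := by
    simp only [T, derivative_add, derivative_mul, derivative_sub, derivative_one,
      derivative_pow, map_natCast, Nat.cast_ofNat, zero_sub, C_mul, C_add, C_1]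
    simp only [map_ofNat]
    simp only [map_ofNat] at hode
    norm_num at hode ⊢
    linear_combination 2 * derivative P * hode
  have key := eval_le_of_derivative_eq_X_mul (A := n * (n + 1)) hT
    (fun y _ => by simp; positivity)
    (by simp [T, hP, legendreP_eval_one]) (by
      simp [T, hP, legendreP_eval_neg_one, ← pow_mul, mul_comm n 2]) hx
  have h3 : (n * (n + 1) : ℝ) * P.eval x ^ 2 ≤ n * (n + 1) * 1 := by
    have : 0 ≤ (1 - x ^ 2) * (derivative P).eval x ^ 2 :=
      mul_nonneg (by nlinarith [hx.1, hx.2]) (sq_nonneg _)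
    simp [T] at key
    linarith
  have := le_of_mul_le_mul_left h3 hν
  exact abs_le_one_iff_mul_self_le_one.mpr (by nlinarith)

lemma one_sub_sq_mul_derivative_legendreP_sq_le (n : ℕ) {x : ℝ} (hx : x ∈ Icc (-1 : ℝ) 1) :
    ((1 - x ^ 2) * (derivative (legendreP (n + 1))).eval x) ^ 2 ≤ 2 * ((n : ℝ) + 1) := by
  set P := legendreP (n + 1) with hP
  have hν : (0 : ℝ) < (n + 1) * (n + 2) := by positivity
  let W : ℝ[X] := (1 - X ^ 2) * derivative P
  let T : ℝ[X] := W ^ 2 + C (((n : ℝ) + 1) * (n + 2)) * (1 - X ^ 2) * P ^ 2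
  have hode : derivative W = -(C (((n : ℝ) + 1) * (n + 2))) * P := by
    have := derivative_one_sub_X_sq_mul_derivative_legendreP (n + 1)
    simp only [W, hP, this]
    simp only [C_mul, C_add, map_natCast, C_1]
    push_cast
    simp only [map_ofNat]
    ring
  have hT : derivative T = -X * (C (2 * ((n : ℝ) + 1) * (n + 2)) * P ^ 2) := by
    simp only [T, derivative_add, derivative_mul, derivative_pow, derivative_C, derivative_sub,
      derivative_one, hode, map_natCast, Nat.cast_ofNat, zero_sub, C_mul, C_add,
      C_1]
    simp only [map_ofNat]
    simp only [W]
    norm_num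
    ring
  have key := eval_le_eval_zero_of_derivative hT (fun y _ => by simp; positivity) hx
  have h0 : (derivative P).eval 0 = (n + 1) * (legendreP n).eval 0 := by
    have := congrArg (eval 0) (one_sub_X_sq_mul_derivative_legendreP n)
    simpa using this
  have hb : T.eval 0 ≤ 2 * ((n : ℝ) + 1) := by
    simp only [T, W, eval_add, eval_mul, eval_pow, eval_sub, eval_one, eval_X, eval_C, h0]
    have a1 := legendreP_eval_zero_sq_le n
    have a2 := legendreP_eval_zero_sq_le (n + 1)
    rw [le_div_iff₀ (by positivity)] at a1 a2
    push_cast at a2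
    rw [← hP] at a2
    have hn : (0 : ℝ) ≤ n := n.cast_nonneg
    nlinarith
  have hc : 0 ≤ (((n : ℝ) + 1) * (n + 2)) * (1 - x ^ 2) * P.eval x ^ 2 :=
    mul_nonneg (mul_nonneg hν.le (by nlinarith [hx.1, hx.2])) (sq_nonneg _)
  have : T.eval x = ((1 - x ^ 2) * (derivative P).eval x) ^ 2
      + (((n : ℝ) + 1) * (n + 2)) * (1 - x ^ 2) * P.eval x ^ 2 := by
    simp [T, W]
  linarith

lemma abs_legendreD_eval_le_two (n : ℕ) {x : ℝ} (hx : x ∈ Icc (-1 : ℝ) 1) :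
    |(legendreD n).eval x| ≤ 2 := by
  cases n with
  | zero =>
    simp only [legendreD, eval_sub, eval_X, eval_one]
    rw [abs_le]
    constructor <;> linarith [hx.1, hx.2]
  | succ n =>
    simp only [legendreD, eval_sub]
    refine (abs_sub _ _).trans ?_
    linarith [abs_legendreP_eval_le_one n hx, abs_legendreP_eval_le_one (n + 2) hx]

lemma legendreD_succ_eval_mul (n : ℕ) (x : ℝ) :
    (n + 1) * (n + 2) * (legendreD (n + 1)).eval x =
      -(2 * n + 3) * ((1 - x ^ 2) * (derivative (legendreP (n + 1))).eval x) := by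
  have h1 := congrArg (eval x) (one_sub_X_sq_mul_derivative_legendreP n)
  have h2 := congrArg (eval x) (legendreP_recurrence n)
  simp only [eval_mul, eval_sub, eval_add, eval_natCast, eval_ofNat, eval_X, eval_one,
    eval_pow] at h1 h2
  simp only [legendreD, eval_sub]
  linear_combination ((n : ℝ) + 1) * h2 + (2 * n + 3) * h1

lemma abs_legendreD_eval_le (n : ℕ) {x : ℝ} (hx : x ∈ Icc (-1 : ℝ) 1) :
    |(legendreD n).eval x| ≤ 4 / Real.sqrt (n + 1) := by
  cases n with
  | zero =>
    have := abs_legendreD_eval_le_two 0 hx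
    simp; linarith
  | succ n =>
    have h1 := one_sub_sq_mul_derivative_legendreP_sq_le n hx
    have h2 := legendreD_succ_eval_mul n x
    have hn : (0 : ℝ) ≤ n := n.cast_nonneg
    have h3 : ((n + 1) * (n + 2) * (legendreD (n + 1)).eval x) ^ 2 ≤
        (2 * n + 3) ^ 2 * (2 * ((n : ℝ) + 1)) := by
      rw [h2, mul_pow, neg_sq]; gcongr
    have h4 : ((legendreD (n + 1)).eval x) ^ 2 * (n + 2) ≤ 16 := by
      rw [mul_pow] at h3
      have h5 : (2 * (n : ℝ) + 3) ^ 2 ≤ (2 * (n + 2)) ^ 2 := by gcongr; linarith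
      have h6 : ((n + 1 : ℝ) * (n + 2) ^ 2) * ((n + 1) * (legendreD (n + 1)).eval x ^ 2) ≤
          ((n + 1 : ℝ) * (n + 2) ^ 2) * 8 := by nlinarith
      have h7 := le_of_mul_le_mul_left h6 (by positivity)
      nlinarith [sq_nonneg ((legendreD (n + 1)).eval x)]
    rw [le_div_iff₀ (by positivity)]
    push_cast
    have h5 : |(legendreD (n + 1)).eval x * Real.sqrt (n + 1 + 1)| ≤ 4 := by
      refine abs_le_of_sq_le_sq ?_ (by norm_num)
      rw [mul_pow, Real.sq_sqrt (by positivity)]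
      linarith
    rwa [abs_mul, abs_of_nonneg (Real.sqrt_nonneg _)] at h5

end LegendreAlgebra

section LegendreIntegrals

open Polynomial

lemma Polynomial.intervalIntegrable_eval (q : ℝ[X]) (a b : ℝ) :
    IntervalIntegrable (fun x => q.eval x) volume a b :=
  q.continuous.intervalIntegrable a b

lemma integral_eval_mul_eval_derivative (u v : ℝ[X]) (a b : ℝ) :
    ∫ x in a..b, u.eval x * (derivative v).eval x =
      u.eval b * v.eval b - u.eval a * v.eval a -
        ∫ x in a..b, (derivative u).eval x * v.eval x :=
  intervalIntegral.integral_mul_deriv_eq_deriv_mul (fun x _ => u.hasDerivAt x)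
    (fun x _ => v.hasDerivAt x) (intervalIntegrable_eval _ _ _) (intervalIntegrable_eval _ _ _)

lemma integral_eval_mul_legendreP_eq_zero {v : ℝ[X]} {n : ℕ} (hv : v.natDegree < n) :
    ∫ x in (-1 : ℝ)..1, v.eval x * (legendreP n).eval x = 0 := by
  induction hd : v.natDegree using Nat.strong_induction_on generalizing v n with
  | _ d ih =>
    obtain ⟨k, rfl⟩ : ∃ k, n = k + 1 := ⟨n - 1, by omega⟩
    have hzero : ∫ x in (-1 : ℝ)..1, (derivative v).eval x * (legendreD (k + 1)).eval x = 0 := by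
      rcases Nat.eq_zero_or_pos d with h0 | h0
      · rw [h0] at hd
        rw [natDegree_eq_zero.mp hd |>.choose_spec.symm]
        simp
      · have hlt : (derivative v).natDegree < v.natDegree := natDegree_derivative_lt (by omega)
        simp only [legendreD, eval_sub, mul_sub]
        rw [intervalIntegral.integral_sub, ih _ (hd ▸ hlt) (by omega) rfl,
          ih _ (hd ▸ hlt) (by omega) rfl, sub_zero]
        · simpa using intervalIntegrable_eval (derivative v * legendreP (k + 2)) (-1) 1
        · simpa using intervalIntegrable_eval (derivative v * legendreP k) (-1) 1
    have h := integral_eval_mul_eval_derivative v (legendreD (k + 1)) (-1) 1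
    rw [hzero, legendreD_eval_one, legendreD_succ_eval_neg_one, derivative_legendreD] at h
    have h2 : ∫ x in (-1 : ℝ)..1, v.eval x *
        ((2 * ((k + 1 : ℕ) : ℝ[X]) + 1) * legendreP (k + 1)).eval x =
        (2 * ((k + 1 : ℕ) : ℝ) + 1) *
          ∫ x in (-1 : ℝ)..1, v.eval x * (legendreP (k + 1)).eval x := by
      rw [← intervalIntegral.integral_const_mul]
      congr 1; ext x; simp; ring
    rw [h2] at h
    have : (2 * ((k + 1 : ℕ) : ℝ) + 1) ≠ 0 := by positivity
    have h' : (2 * ((k + 1 : ℕ) : ℝ) + 1) *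
        ∫ x in (-1 : ℝ)..1, v.eval x * (legendreP (k + 1)).eval x = 0 := by rw [h]; simp
    exact (mul_eq_zero.mp h').resolve_left this

lemma integral_legendreP_mul_legendreP_of_ne {m n : ℕ} (h : m ≠ n) :
    ∫ x in (-1 : ℝ)..1, (legendreP m).eval x * (legendreP n).eval x = 0 := by
  rcases h.lt_or_gt with h | h
  · exact integral_eval_mul_legendreP_eq_zero ((natDegree_legendreP_le m).trans_lt h)
  · simp_rw [mul_comm ((legendreP m).eval _)]
    exact integral_eval_mul_legendreP_eq_zero ((natDegree_legendreP_le n).trans_lt h)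

lemma integral_legendreP_sq (n : ℕ) :
    ∫ x in (-1 : ℝ)..1, (legendreP n).eval x * (legendreP n).eval x = 2 / (2 * n + 1) := by
  cases n with
  | zero => simp [legendreP_zero]; norm_num
  | succ n =>
    set P := legendreP (n + 1) with hP
    have hibp := integral_eval_mul_eval_derivative (X * P) P (-1) 1
    have hX : X * derivative P = derivative (legendreP n) + ((n : ℝ[X]) + 1) * P := by
      linear_combination X_mul_derivative_legendreP_succ n
    have horth : ∫ x in (-1 : ℝ)..1, (derivative (legendreP n)).eval x * P.eval x = 0 :=
      integral_eval_mul_legendreP_eq_zero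
        (by have := natDegree_derivative_le (legendreP n); have := natDegree_legendreP_le n; omega)
    have hi : ∫ x in (-1 : ℝ)..1, ((derivative (legendreP n)).eval x * P.eval x +
        ((n : ℝ) + 1) * (P.eval x * P.eval x)) =
        ((n : ℝ) + 1) * ∫ x in (-1 : ℝ)..1, P.eval x * P.eval x := by
      rw [intervalIntegral.integral_add, horth, intervalIntegral.integral_const_mul, zero_add]
      · simpa using intervalIntegrable_eval (derivative (legendreP n) * P) (-1) 1
      · simpa using (intervalIntegrable_eval (P * P) (-1) 1).const_mul ((n : ℝ) + 1)
    have e1 : ∫ x in (-1 : ℝ)..1, (X * P).eval x * (derivative P).eval x =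
        ((n : ℝ) + 1) * ∫ x in (-1 : ℝ)..1, P.eval x * P.eval x := by
      rw [← hi]
      congr 1; ext x
      have := congrArg (eval x) hX
      simp only [eval_mul, eval_X, eval_add, eval_natCast, eval_one] at this ⊢
      linear_combination P.eval x * this
    have e2 : ∫ x in (-1 : ℝ)..1, (derivative (X * P)).eval x * P.eval x =
        (((n : ℝ) + 1) * ∫ x in (-1 : ℝ)..1, P.eval x * P.eval x) +
          ∫ x in (-1 : ℝ)..1, P.eval x * P.eval x := by
      rw [← hi, ← intervalIntegral.integral_add]
      · congr 1; ext x
        have := congrArg (eval x) hX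
        simp only [derivative_mul, derivative_X, eval_mul, eval_X, eval_add, eval_natCast,
          eval_one] at this ⊢
        linear_combination P.eval x * this
      · apply Continuous.intervalIntegrable; fun_prop
      · apply Continuous.intervalIntegrable; fun_prop
    rw [e1, e2] at hibp
    have hsq : ((-1 : ℝ) ^ (n + 1)) * (-1) ^ (n + 1) = 1 := by
      rw [← mul_pow]; norm_num
    simp only [eval_mul, eval_X, hP, legendreP_eval_one, legendreP_eval_neg_one] at hibp
    rw [← hP] at hibp
    push_cast
    rw [eq_div_iff (by positivity)]
    linarith

lemma span_range_legendreP : Submodule.span ℝ (range legendreP) = ⊤ := by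
  set S := Submodule.span ℝ (range legendreP) with hS
  have hmem : ∀ n, legendreP n ∈ S := fun n => Submodule.subset_span ⟨n, rfl⟩
  have hXP : ∀ n, X * legendreP n ∈ S := by
    intro n
    cases n with
    | zero => simpa [legendreP_zero, legendreP_one] using hmem 1
    | succ n =>
      have h : X * legendreP (n + 1) = (2 * (n : ℝ) + 3)⁻¹ •
          (((n : ℝ) + 2) • legendreP (n + 2) + ((n : ℝ) + 1) • legendreP n) := by
        have hr := legendreP_recurrence n
        have h0 : (2 * (n : ℝ) + 3) ≠ 0 := by positivity
        rw [eq_inv_smul_iff₀ h0]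
        simp only [smul_eq_C_mul, C_add, C_mul, map_natCast, C_1, map_ofNat]
        linear_combination -hr
      rw [h]
      exact S.smul_mem _ (S.add_mem (S.smul_mem _ (hmem _)) (S.smul_mem _ (hmem _)))
  have hX : ∀ q ∈ S, X * q ∈ S := by
    intro q hq
    induction hq using Submodule.span_induction with
    | mem x hx => obtain ⟨n, rfl⟩ := hx; exact hXP n
    | zero => simp
    | add x y _ _ hx hy => rw [mul_add]; exact S.add_mem hx hy
    | smul a x _ hx => rw [mul_smul_comm]; exact S.smul_mem _ hx
  have hXn : ∀ n : ℕ, (X : ℝ[X]) ^ n ∈ S := by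
    intro n
    induction n with
    | zero => simpa [legendreP_zero] using hmem 0
    | succ n ih => rw [pow_succ']; exact hX _ ih
  refine eq_top_iff.mpr fun q _ => ?_
  rw [q.as_sum_range_C_mul_X_pow]
  refine S.sum_mem fun i _ => ?_
  rw [← smul_eq_C_mul]
  exact S.smul_mem _ (hXn i)

lemma exists_eq_sum_legendreP (q : ℝ[X]) :
    ∃ (s : Finset ℕ) (c : ℕ → ℝ), q = ∑ n ∈ s, c n • legendreP n := by
  have h : q ∈ Submodule.span ℝ (range legendreP) := by simp [span_range_legendreP]
  obtain ⟨c, hc⟩ := Finsupp.mem_span_range_iff_exists_finsupp.mp h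
  exact ⟨c.support, c, hc.symm⟩

/-- The mean square of a continuous function is controlled by its Legendre coefficients. -/
lemma integral_sq_le_of_legendre_coeff {E : ℝ → ℝ} (hE : ContinuousOn E (Icc (-1) 1)) {B : ℝ}
    (hB : ∀ s : Finset ℕ, ∑ n ∈ s, (2 * (n : ℝ) + 1) / 2 *
      (∫ x in (-1 : ℝ)..1, E x * (legendreP n).eval x) ^ 2 ≤ B) :
    ∫ x in (-1 : ℝ)..1, E x ^ 2 ≤ B := by
  refine le_of_forall_pos_le_add fun ε hε => ?_
  obtain ⟨Q, hQ⟩ := exists_polynomial_near_of_continuousOn (-1) 1 E hE (Real.sqrt (ε / 2))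
    (by positivity)
  obtain ⟨s, c, hc⟩ := exists_eq_sum_legendreP Q
  have huIcc : uIcc (-1 : ℝ) 1 = Icc (-1) 1 := uIcc_of_le (by norm_num)
  have hEi : ∀ q : ℝ[X], IntervalIntegrable (fun x => E x * q.eval x) volume (-1) 1 := fun q =>
    ContinuousOn.intervalIntegrable (by rw [huIcc]; exact hE.mul q.continuous.continuousOn)
  have hE2 : IntervalIntegrable (fun x => E x ^ 2) volume (-1) 1 :=
    ContinuousOn.intervalIntegrable (by rw [huIcc]; exact hE.pow 2)
  have hevalQ : ∀ x, Q.eval x = ∑ n ∈ s, c n * (legendreP n).eval x := fun x => by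
    conv_lhs => rw [hc]
    simp [eval_finsetSum]
  have hEQ : ∫ x in (-1 : ℝ)..1, E x * Q.eval x =
      ∑ n ∈ s, c n * ∫ x in (-1 : ℝ)..1, E x * (legendreP n).eval x := by
    simp_rw [hevalQ, Finset.mul_sum]
    rw [intervalIntegral.integral_finsetSum]
    · refine Finset.sum_congr rfl fun n _ => ?_
      rw [← intervalIntegral.integral_const_mul]
      congr 1; ext x; ring
    · intro n _
      convert (hEi (legendreP n)).const_mul (c n) using 2; ring
  have hPQ : ∀ n ∈ s, ∫ x in (-1 : ℝ)..1, (legendreP n).eval x * Q.eval x =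
      c n * (2 / (2 * n + 1)) := by
    intro n hn
    simp_rw [hevalQ, Finset.mul_sum]
    rw [intervalIntegral.integral_finsetSum]
    · rw [Finset.sum_eq_single_of_mem n hn]
      · rw [← integral_legendreP_sq, ← intervalIntegral.integral_const_mul]
        congr 1; ext x; ring
      · intro m _ hmn
        calc ∫ x in (-1 : ℝ)..1, (legendreP n).eval x * (c m * (legendreP m).eval x)
            = c m * ∫ x in (-1 : ℝ)..1, (legendreP n).eval x * (legendreP m).eval x := by
              rw [← intervalIntegral.integral_const_mul]
              congr 1; ext x; ring
          _ = 0 := by rw [integral_legendreP_mul_legendreP_of_ne hmn.symm, mul_zero]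
    · intro m _
      apply Continuous.intervalIntegrable; fun_prop
  have hQQ : ∫ x in (-1 : ℝ)..1, Q.eval x * Q.eval x =
      ∑ n ∈ s, c n * (c n * (2 / (2 * n + 1))) := by
    have : ∀ x, Q.eval x * Q.eval x = ∑ n ∈ s, c n * ((legendreP n).eval x * Q.eval x) :=
        fun x => by
      simp_rw [← mul_assoc, ← Finset.sum_mul, ← hevalQ]
    simp_rw [this]
    rw [intervalIntegral.integral_finsetSum]
    · refine Finset.sum_congr rfl fun n hn => ?_
      rw [intervalIntegral.integral_const_mul, hPQ n hn]
    · intro m _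
      apply Continuous.intervalIntegrable; fun_prop
  have hnear : ∫ x in (-1 : ℝ)..1, (E x - Q.eval x) ^ 2 ≤ ε := by
    calc ∫ x in (-1 : ℝ)..1, (E x - Q.eval x) ^ 2 ≤ ∫ x in (-1 : ℝ)..1, ε / 2 := by
          refine intervalIntegral.integral_mono_on (by norm_num) ?_ (by simp) fun x hx => ?_
          · exact ContinuousOn.intervalIntegrable
              (by rw [huIcc]; exact (hE.sub Q.continuous.continuousOn).pow 2)
          · have := hQ x hx
            rw [abs_sub_comm] at this
            calc (E x - Q.eval x) ^ 2 = |E x - Q.eval x| ^ 2 := (sq_abs _).symm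
              _ ≤ Real.sqrt (ε / 2) ^ 2 := by gcongr
              _ = ε / 2 := Real.sq_sqrt (by positivity)
      _ = ε := by simp; ring
  have hexp : ∫ x in (-1 : ℝ)..1, (E x - Q.eval x) ^ 2 = (∫ x in (-1 : ℝ)..1, E x ^ 2) -
      2 * (∫ x in (-1 : ℝ)..1, E x * Q.eval x) + ∫ x in (-1 : ℝ)..1, Q.eval x * Q.eval x := by
    rw [← intervalIntegral.integral_const_mul, ← intervalIntegral.integral_sub hE2
      ((hEi Q).const_mul 2), ← intervalIntegral.integral_add (hE2.sub ((hEi Q).const_mul 2))]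
    · congr 1; ext x; ring
    · apply Continuous.intervalIntegrable; fun_prop
  have hcs : 2 * (∫ x in (-1 : ℝ)..1, E x * Q.eval x) - ∫ x in (-1 : ℝ)..1, Q.eval x * Q.eval x ≤
      ∑ n ∈ s, (2 * (n : ℝ) + 1) / 2 * (∫ x in (-1 : ℝ)..1, E x * (legendreP n).eval x) ^ 2 := by
    rw [hEQ, hQQ, Finset.mul_sum, ← Finset.sum_sub_distrib]
    refine Finset.sum_le_sum fun n _ => ?_
    set e := ∫ x in (-1 : ℝ)..1, E x * (legendreP n).eval x
    have hw : (0 : ℝ) < 2 * n + 1 := by positivity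
    have : (2 * (n : ℝ) + 1) / 2 * e ^ 2 - (2 * (c n * e) - c n * (c n * (2 / (2 * n + 1)))) =
        2 / (2 * n + 1) * ((2 * n + 1) / 2 * e - c n) ^ 2 := by
      field_simp; ring
    have h2 : 0 ≤ 2 / (2 * (n : ℝ) + 1) * ((2 * n + 1) / 2 * e - c n) ^ 2 := by positivity
    linarith
  linarith [hB s]

end LegendreIntegrals

section TruncatedMoments

open Polynomial

/-- The truncated moment `∫_t^1 (x - t)^γ q(x) dx`. -/
noncomputable def truncMoment (γ : ℝ) (q : ℝ[X]) (t : ℝ) : ℝ :=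
  ∫ x in t..1, (x - t) ^ γ * q.eval x

lemma intervalIntegrable_sub_rpow {γ : ℝ} (hγ : -1 < γ) (t a b : ℝ) :
    IntervalIntegrable (fun x => (x - t) ^ γ) volume a b := by
  have h :=
    (intervalIntegral.intervalIntegrable_rpow' hγ (a := a - t) (b := b - t)).comp_sub_right t
  simpa using h

lemma intervalIntegrable_sub_rpow_mul {γ : ℝ} (hγ : -1 < γ) (q : ℝ[X]) (t a b : ℝ) :
    IntervalIntegrable (fun x => (x - t) ^ γ * q.eval x) volume a b :=
  (intervalIntegrable_sub_rpow hγ t a b).mul_continuousOn q.continuous.continuousOn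

lemma integral_sub_rpow {γ : ℝ} (hγ : -1 < γ) (t b : ℝ) :
    ∫ x in t..b, (x - t) ^ γ = (b - t) ^ (γ + 1) / (γ + 1) := by
  rw [intervalIntegral.integral_comp_sub_right (fun x => x ^ γ), integral_rpow (Or.inl hγ),
      sub_self,
    Real.zero_rpow (by linarith), sub_zero]

lemma truncMoment_add {γ : ℝ} (hγ : -1 < γ) (p q : ℝ[X]) (t : ℝ) :
    truncMoment γ (p + q) t = truncMoment γ p t + truncMoment γ q t := by
  simp only [truncMoment, eval_add, mul_add]
  exact intervalIntegral.integral_add (intervalIntegrable_sub_rpow_mul hγ p t t 1)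
    (intervalIntegrable_sub_rpow_mul hγ q t t 1)

lemma truncMoment_sub {γ : ℝ} (hγ : -1 < γ) (p q : ℝ[X]) (t : ℝ) :
    truncMoment γ (p - q) t = truncMoment γ p t - truncMoment γ q t := by
  simp only [truncMoment, eval_sub, mul_sub]
  exact intervalIntegral.integral_sub (intervalIntegrable_sub_rpow_mul hγ p t t 1)
    (intervalIntegrable_sub_rpow_mul hγ q t t 1)

lemma truncMoment_const_mul (γ c : ℝ) (q : ℝ[X]) (t : ℝ) :
    truncMoment γ (C c * q) t = c * truncMoment γ q t := by
  simp only [truncMoment, eval_mul, eval_C, ← intervalIntegral.integral_const_mul]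
  congr 1; ext x; ring

lemma truncMoment_derivative {γ : ℝ} (hγ : 0 < γ) {Q : ℝ[X]} (hQ : Q.eval 1 = 0) {t : ℝ}
    (ht : t ≤ 1) : truncMoment γ (derivative Q) t = -γ * truncMoment (γ - 1) Q t := by
  have h := intervalIntegral.integral_mul_deriv_eq_deriv_mul_of_hasDerivAt (a := t) (b := 1)
    (u := fun x => (x - t) ^ γ) (u' := fun x => γ * (x - t) ^ (γ - 1))
    (v := fun x => Q.eval x) (v' := fun x => (derivative Q).eval x)
    (Continuous.continuousOn (by
      exact (continuous_id.sub continuous_const).rpow_const (fun _ => Or.inr hγ.le)))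
    Q.continuous.continuousOn (fun x hx => by
      rw [min_eq_left ht] at hx
      have h1 := ((hasDerivAt_id x).sub_const t).rpow_const (p := γ)
        (Or.inl (by simp; linarith [hx.1]))
      simpa using h1)
    (fun x _ => Q.hasDerivAt x)
    ((intervalIntegrable_sub_rpow (by linarith) t t 1).const_mul γ)
    (Polynomial.intervalIntegrable_eval _ _ _)
  simp only [hQ, mul_zero, sub_self, Real.zero_rpow hγ.ne', zero_mul] at h
  simp only [truncMoment, h, ← intervalIntegral.integral_const_mul]
  rw [zero_sub, ← intervalIntegral.integral_neg]
  congr 1; ext x; ring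

/-- An oscillatory estimate: if `q = Q'` with `q = O(A)` and `Q = O(A h)`, then integrating `q`
against the weakly singular kernel `(x - t)^γ` gains a factor `h^(γ+1)`. -/
lemma abs_truncMoment_derivative_le {γ : ℝ} (hγ : -1 < γ) (hγ0 : γ ≤ 0) {Q : ℝ[X]}
    (hQ1 : Q.eval 1 = 0) {A h : ℝ} (hh : 0 < h)
    (hq : ∀ x ∈ Icc (-1 : ℝ) 1, |(derivative Q).eval x| ≤ A)
    (hQ : ∀ x ∈ Icc (-1 : ℝ) 1, |Q.eval x| ≤ A * h) {t : ℝ} (ht : t ∈ Icc (-1 : ℝ) 1) :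
    |truncMoment γ (derivative Q) t| ≤ (1 / (γ + 1) + 2) * (A * h ^ (γ + 1)) := by
  have hA : 0 ≤ A := (abs_nonneg _).trans (hq t ht)
  have hγ1 : 0 < γ + 1 := by linarith
  have hhp : 0 < h ^ (γ + 1) := Real.rpow_pos_of_pos hh _
  have near : ∀ b, t ≤ b → b ≤ 1 → b - t ≤ h →
      |∫ x in t..b, (x - t) ^ γ * (derivative Q).eval x| ≤ 1 / (γ + 1) * (A * h ^ (γ + 1)) := by
    intro b htb hb1 hbh
    calc |∫ x in t..b, (x - t) ^ γ * (derivative Q).eval x|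
        ≤ ∫ x in t..b, (x - t) ^ γ * A := by
          rw [← Real.norm_eq_abs]
          refine intervalIntegral.norm_integral_le_of_norm_le htb ?_
            ((intervalIntegrable_sub_rpow hγ t t b).mul_const A)
          refine ae_of_all _ fun x hx => ?_
          rw [norm_mul, Real.norm_of_nonneg (Real.rpow_nonneg (by linarith [hx.1]) _)]
          have := hq x ⟨by linarith [hx.1, ht.1], by linarith [hx.2]⟩
          exact mul_le_mul_of_nonneg_left this (Real.rpow_nonneg (by linarith [hx.1]) _)
      _ = (b - t) ^ (γ + 1) / (γ + 1) * A := by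
          rw [intervalIntegral.integral_mul_const, integral_sub_rpow hγ]
      _ ≤ h ^ (γ + 1) / (γ + 1) * A := by
          have : (b - t) ^ (γ + 1) ≤ h ^ (γ + 1) :=
            Real.rpow_le_rpow (by linarith) hbh hγ1.le
          gcongr
      _ = _ := by ring
  rcases le_or_gt 1 (t + h) with hth | hth
  · refine (near 1 ht.2 le_rfl (by linarith)).trans ?_
    have : 0 ≤ 2 * (A * h ^ (γ + 1)) := by positivity
    linarith
  · have hsplit := intervalIntegral.integral_add_adjacent_intervals
      (intervalIntegrable_sub_rpow_mul hγ (derivative Q) t t (t + h))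
      (intervalIntegrable_sub_rpow_mul hγ (derivative Q) t (t + h) 1)
    have hpos : ∀ x ∈ uIcc (t + h) 1, 0 < x - t := fun x hx => by
      rw [uIcc_of_le hth.le] at hx; linarith [hx.1]
    have hder : ∀ x ∈ uIcc (t + h) 1,
        HasDerivAt (fun x => (x - t) ^ γ) (γ * (x - t) ^ (γ - 1)) x := fun x hx => by
      have h1 := ((hasDerivAt_id x).sub_const t).rpow_const (p := γ)
        (Or.inl (by simpa using (hpos x hx).ne'))
      simpa using h1
    have hu' : IntervalIntegrable (fun x => γ * (x - t) ^ (γ - 1)) volume (t + h) 1 := by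
      refine ContinuousOn.intervalIntegrable (continuousOn_const.mul ?_)
      exact ContinuousOn.rpow_const (by fun_prop) fun x hx => Or.inl (hpos x hx).ne'
    have hibp := intervalIntegral.integral_mul_deriv_eq_deriv_mul hder
      (fun x _ => Q.hasDerivAt x) hu' (Polynomial.intervalIntegrable_eval _ _ _)
    have hmem : t + h ∈ Icc (-1 : ℝ) 1 := ⟨by linarith [ht.1], hth.le⟩
    have hfar : |∫ x in (t + h)..1, γ * (x - t) ^ (γ - 1) * Q.eval x| ≤ A * h ^ (γ + 1) := by
      calc |∫ x in (t + h)..1, γ * (x - t) ^ (γ - 1) * Q.eval x|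
          ≤ ∫ x in (t + h)..1, -(γ * (x - t) ^ (γ - 1)) * (A * h) := by
            rw [← Real.norm_eq_abs]
            refine intervalIntegral.norm_integral_le_of_norm_le hth.le ?_
              (hu'.neg.mul_const _)
            refine ae_of_all _ fun x hx => ?_
            have hx0 : 0 ≤ (x - t) ^ (γ - 1) := Real.rpow_nonneg (by linarith [hx.1]) _
            rw [norm_mul, norm_mul, Real.norm_of_nonpos hγ0, Real.norm_of_nonneg hx0, ← neg_mul]
            exact mul_le_mul_of_nonneg_left (hQ x ⟨by linarith [hx.1, ht.1], hx.2⟩)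
              (mul_nonneg (by linarith) hx0)
        _ = (h ^ γ - (1 - t) ^ γ) * (A * h) := by
            rw [intervalIntegral.integral_mul_const, intervalIntegral.integral_neg,
              intervalIntegral.integral_eq_sub_of_hasDerivAt hder hu']
            congr 1; simp
        _ ≤ h ^ γ * (A * h) := by
            have : 0 ≤ (1 - t) ^ γ := Real.rpow_nonneg (by linarith [ht.2]) _
            gcongr; linarith
        _ = A * h ^ (γ + 1) := by rw [Real.rpow_add_one hh.ne']; ring
    have hbd : |h ^ γ * Q.eval (t + h)| ≤ A * h ^ (γ + 1) := by
      rw [abs_mul, abs_of_pos (Real.rpow_pos_of_pos hh _), Real.rpow_add_one hh.ne']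
      have := mul_le_mul_of_nonneg_left (hQ _ hmem) (Real.rpow_pos_of_pos hh γ).le
      linarith
    rw [hQ1, add_sub_cancel_left, mul_zero, zero_sub] at hibp
    rw [truncMoment, ← hsplit, hibp]
    have h1 := near (t + h) (by linarith) hth.le (by linarith)
    rw [abs_le] at *
    constructor <;> linarith [h1.1, h1.2, hbd.1, hbd.2, hfar.1, hfar.2]

lemma truncMoment_legendreP {γ : ℝ} (hγ : 0 < γ) (n : ℕ) {t : ℝ} (ht : t ≤ 1) :
    (2 * (n : ℝ) + 1) * truncMoment γ (legendreP n) t =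
      -γ * truncMoment (γ - 1) (legendreD n) t := by
  rw [← truncMoment_derivative hγ (legendreD_eval_one n) ht, derivative_legendreD,
    ← truncMoment_const_mul]
  simp [map_ofNat C]

end TruncatedMoments

section MomentBounds

open Polynomial

lemma legendreD_eq (n : ℕ) : legendreD n = legendreP (n + 1) - legendreP (n - 1) := by
  cases n <;> simp [legendreD, legendreP_zero, legendreP_one]

lemma exists_truncMoment_legendreP_bound_succ {γ s C : ℝ} (hγ : 0 < γ) (hs : 0 ≤ s)
    (hC : ∀ (n : ℕ), ∀ t ∈ Icc (-1 : ℝ) 1,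
      |truncMoment (γ - 1) (legendreP n) t| ≤ C * ((n : ℝ) + 1) ^ (-s)) :
    ∃ C', ∀ (n : ℕ), ∀ t ∈ Icc (-1 : ℝ) 1,
      |truncMoment γ (legendreP n) t| ≤ C' * ((n : ℝ) + 1) ^ (-(s + 1)) := by
  have hC0 : 0 ≤ C := by
    have := (abs_nonneg _).trans (hC 0 0 (by simp))
    simpa using this
  refine ⟨γ * (2 * C * 2 ^ s), fun n t ht => ?_⟩
  have hn : (0 : ℝ) ≤ n := n.cast_nonneg
  have hrec := truncMoment_legendreP hγ n ht.2
  rw [legendreD_eq, truncMoment_sub (by linarith)] at hrec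
  have key : ∀ m : ℕ, (n : ℝ) + 1 ≤ 2 * (m + 1) →
      |truncMoment (γ - 1) (legendreP m) t| ≤ C * 2 ^ s * ((n : ℝ) + 1) ^ (-s) := fun m hm => by
    refine (hC m t ht).trans ?_
    have h1 : ((m : ℝ) + 1) ^ (-s) ≤ (((n : ℝ) + 1) / 2) ^ (-s) :=
      Real.rpow_le_rpow_of_nonpos (by positivity) (by linarith) (by linarith)
    have h2 : (((n : ℝ) + 1) / 2) ^ (-s) = 2 ^ s * ((n : ℝ) + 1) ^ (-s) := by
      rw [Real.div_rpow (by positivity) (by norm_num), Real.rpow_neg (by norm_num : (0 : ℝ) ≤ 2),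
        div_inv_eq_mul, mul_comm]
    rw [mul_assoc, ← h2]
    gcongr
  have k1 := key (n + 1) (by push_cast; linarith)
  have k2 := key (n - 1) (by
    have : n ≤ (n - 1) + 1 := by omega
    have : (n : ℝ) ≤ ((n - 1 : ℕ) : ℝ) + 1 := by exact_mod_cast this
    have : (0 : ℝ) ≤ ((n - 1 : ℕ) : ℝ) := Nat.cast_nonneg _
    linarith)
  have hmul : ((n : ℝ) + 1) * |truncMoment γ (legendreP n) t| ≤
      γ * (2 * C * 2 ^ s) * ((n : ℝ) + 1) ^ (-s) := by
    calc ((n : ℝ) + 1) * |truncMoment γ (legendreP n) t|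
        ≤ (2 * (n : ℝ) + 1) * |truncMoment γ (legendreP n) t| := by gcongr; linarith
      _ = γ * |truncMoment (γ - 1) (legendreP (n + 1)) t -
            truncMoment (γ - 1) (legendreP (n - 1)) t| := by
          have := congrArg abs hrec
          rwa [abs_mul, abs_mul, abs_neg, abs_of_pos hγ, abs_of_pos (by positivity)] at this
      _ ≤ γ * (C * 2 ^ s * ((n : ℝ) + 1) ^ (-s) + C * 2 ^ s * ((n : ℝ) + 1) ^ (-s)) := by
          gcongr
          exact (abs_sub _ _).trans (add_le_add k1 k2)
      _ = _ := by ring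
  have hpos : (0 : ℝ) < n + 1 := by positivity
  rw [neg_add, Real.rpow_add hpos, Real.rpow_neg_one, ← mul_assoc, ← div_eq_mul_inv,
    le_div_iff₀ hpos]
  linarith

/-- Truncated moments of the Legendre polynomials are `O(n^{-(γ+1)})`, uniformly in `t`. -/
lemma exists_truncMoment_legendreP_bound {γ : ℝ} (hγ : -1 < γ) :
    ∃ C, ∀ (n : ℕ), ∀ t ∈ Icc (-1 : ℝ) 1,
      |truncMoment γ (legendreP n) t| ≤ C * ((n : ℝ) + 1) ^ (-(γ + 1)) := by
  obtain ⟨N, hN⟩ := exists_nat_ge γ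
  induction N generalizing γ with
  | zero =>
    have hN' : γ ≤ 0 := by simpa using hN
    refine ⟨(1 / (γ + 1) + 2) * 2 ^ (γ + 1), fun n t ht => ?_⟩
    have hn : (0 : ℝ) ≤ n := n.cast_nonneg
    have hQ' : derivative (C ((2 * (n : ℝ) + 1)⁻¹) * legendreD n) = legendreP n := by
      rw [derivative_C_mul, derivative_legendreD, ← mul_assoc]
      have : (2 * (n : ℝ[X]) + 1) = C (2 * (n : ℝ) + 1) := by simp [map_ofNat C]
      rw [this, ← C_mul, inv_mul_cancel₀ (by positivity), C_1, one_mul]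
    have h := abs_truncMoment_derivative_le (A := 1) (h := 2 / ((n : ℝ) + 1)) hγ hN'
      (Q := C ((2 * (n : ℝ) + 1)⁻¹) * legendreD n) (by simp [legendreD_eval_one]) (by positivity)
      (fun x hx => by rw [hQ']; exact abs_legendreP_eval_le_one n hx)
      (fun x hx => by
        rw [eval_mul, eval_C, abs_mul, abs_of_nonneg (by positivity), one_mul]
        calc (2 * (n : ℝ) + 1)⁻¹ * |(legendreD n).eval x| ≤ ((n : ℝ) + 1)⁻¹ * 2 := by
              gcongr
              · linarith
              · exact abs_legendreD_eval_le_two n hx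
          _ = _ := by ring) ht
    rw [hQ', Real.div_rpow (by norm_num) (by positivity)] at h
    rw [Real.rpow_neg (by positivity)]
    calc _ ≤ _ := h
      _ = _ := by ring
  | succ N ih =>
    rcases le_or_gt γ 0 with h0 | h0
    · exact ih hγ (h0.trans N.cast_nonneg)
    · push_cast at hN
      obtain ⟨C, hC⟩ := ih (γ := γ - 1) (by linarith) (by linarith)
      rw [sub_add_cancel] at hC
      exact exists_truncMoment_legendreP_bound_succ h0 h0.le hC

/-- For `γ > 0` the bound on truncated moments improves by half an order. -/
lemma exists_truncMoment_legendreP_bound_of_pos {γ : ℝ} (hγ : 0 < γ) :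
    ∃ C, ∀ (n : ℕ), ∀ t ∈ Icc (-1 : ℝ) 1,
      |truncMoment γ (legendreP n) t| ≤ C * ((n : ℝ) + 1) ^ (-(γ + 3 / 2)) := by
  obtain ⟨N, hN⟩ := exists_nat_ge (γ - 1)
  induction N generalizing γ with
  | zero =>
    have hN' : γ - 1 ≤ 0 := by simpa using hN
    obtain ⟨C₀, hC₀⟩ := exists_truncMoment_legendreP_bound (γ := γ) (by linarith)
    set K : ℝ := γ * ((1 / γ + 2) * (4 * 5 ^ γ)) with hK
    have hK0 : 0 ≤ K := by positivity
    refine ⟨max C₀ K, fun n t ht => ?_⟩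
    rcases Nat.eq_zero_or_pos n with rfl | hn0
    · have := hC₀ 0 t ht
      simp at this ⊢
      exact Or.inl this
    have hn1 : (1 : ℝ) ≤ n := by exact_mod_cast hn0
    have hsq : 0 < Real.sqrt ((n : ℝ) + 1) := by positivity
    obtain ⟨m, rfl⟩ : ∃ m, n = m + 1 := ⟨n - 1, by omega⟩
    have hm : (0 : ℝ) ≤ m := m.cast_nonneg
    set Q : ℝ[X] := C ((2 * (m : ℝ) + 5)⁻¹) * legendreD (m + 2) -
      C ((2 * (m : ℝ) + 1)⁻¹) * legendreD m with hQdef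
    have hQ' : derivative Q = legendreD (m + 1) := by
      simp only [hQdef, derivative_sub, derivative_C_mul, derivative_legendreD]
      have h1 : (2 * (m : ℝ[X]) + 1) = C (2 * (m : ℝ) + 1) := by simp [map_ofNat C]
      have h2 : (2 * ((m + 2 : ℕ) : ℝ[X]) + 1) = C (2 * (m : ℝ) + 5) := by
        simp only [C_add, C_mul, map_ofNat, map_natCast]; push_cast; ring
      rw [h1, h2, ← mul_assoc, ← mul_assoc, ← C_mul, ← C_mul, inv_mul_cancel₀ (by positivity),
        inv_mul_cancel₀ (by positivity), C_1, one_mul, one_mul, legendreD]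
    have hrec := truncMoment_legendreP hγ (m + 1) ht.2
    have h := abs_truncMoment_derivative_le (γ := γ - 1)
      (A := 4 / Real.sqrt (((m + 1 : ℕ) : ℝ) + 1))
      (h := 5 / (((m + 1 : ℕ) : ℝ) + 1)) (by linarith) hN' (Q := Q)
      (by simp [hQdef, legendreD_eval_one]) (by positivity)
      (fun x hx => by rw [hQ']; exact abs_legendreD_eval_le (m + 1) hx)
      (fun x hx => by
        have hs1 : Real.sqrt (((m + 1 : ℕ) : ℝ) + 1) ≤ Real.sqrt (((m + 2 : ℕ) : ℝ) + 1) :=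
          Real.sqrt_le_sqrt (by push_cast; linarith)
        have hs2 : Real.sqrt (((m + 1 : ℕ) : ℝ) + 1) ≤ 2 * Real.sqrt ((m : ℝ) + 1) := by
          rw [show (2 : ℝ) = Real.sqrt 4 by
            rw [show (4 : ℝ) = 2 ^ 2 by norm_num]; exact (Real.sqrt_sq (by norm_num)).symm,
            ← Real.sqrt_mul (by norm_num)]
          exact Real.sqrt_le_sqrt (by push_cast; linarith)
        have hb1 := (abs_legendreD_eval_le (m + 2) hx).trans
          (div_le_div_of_nonneg_left (by norm_num) hsq hs1)
        have hb2 : |(legendreD m).eval x| ≤ 8 / Real.sqrt (((m + 1 : ℕ) : ℝ) + 1) := by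
          refine (abs_legendreD_eval_le m hx).trans ?_
          rw [div_le_div_iff₀ (by positivity) hsq]
          linarith
        simp only [hQdef, eval_sub, eval_mul, eval_C]
        refine (abs_sub _ _).trans ?_
        rw [abs_mul, abs_mul, abs_of_nonneg (by positivity : (0 : ℝ) ≤ (2 * (m : ℝ) + 5)⁻¹),
          abs_of_nonneg (by positivity : (0 : ℝ) ≤ (2 * (m : ℝ) + 1)⁻¹)]
        have hi1 : (2 * (m : ℝ) + 5)⁻¹ ≤ (1 / 2) * (((m + 1 : ℕ) : ℝ) + 1)⁻¹ := by
          rw [← div_eq_mul_inv, inv_eq_one_div, div_le_div_iff₀ (by positivity) (by positivity)]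
          push_cast; linarith
        have hi2 : (2 * (m : ℝ) + 1)⁻¹ ≤ 2 * (((m + 1 : ℕ) : ℝ) + 1)⁻¹ := by
          rw [← div_eq_mul_inv, inv_eq_one_div, div_le_div_iff₀ (by positivity) (by positivity)]
          push_cast; linarith
        calc _ ≤ (1 / 2) * (((m + 1 : ℕ) : ℝ) + 1)⁻¹ * (4 / Real.sqrt (((m + 1 : ℕ) : ℝ) + 1)) +
              2 * (((m + 1 : ℕ) : ℝ) + 1)⁻¹ * (8 / Real.sqrt (((m + 1 : ℕ) : ℝ) + 1)) := by
              gcongr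
          _ = 18 * ((((m + 1 : ℕ) : ℝ) + 1)⁻¹ * (Real.sqrt (((m + 1 : ℕ) : ℝ) + 1))⁻¹) := by ring
          _ ≤ 20 * ((((m + 1 : ℕ) : ℝ) + 1)⁻¹ * (Real.sqrt (((m + 1 : ℕ) : ℝ) + 1))⁻¹) := by
              gcongr; norm_num
          _ = _ := by ring) ht
    rw [hQ', sub_add_cancel] at h
    set ν : ℝ := ((m + 1 : ℕ) : ℝ) + 1 with hν
    have hνpos : 0 < ν := by positivity
    have hmul : ν * |truncMoment γ (legendreP (m + 1)) t| ≤
        K * (ν ^ (-γ) * ν ^ (-(1 / 2) : ℝ)) := by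
      calc ν * |truncMoment γ (legendreP (m + 1)) t|
          ≤ (2 * ((m + 1 : ℕ) : ℝ) + 1) * |truncMoment γ (legendreP (m + 1)) t| := by
            gcongr; linarith
        _ = γ * |truncMoment (γ - 1) (legendreD (m + 1)) t| := by
            have := congrArg abs hrec
            rwa [abs_mul, abs_mul, abs_neg, abs_of_pos hγ, abs_of_pos (by positivity)] at this
        _ ≤ γ * ((1 / γ + 2) * (4 / Real.sqrt ν * (5 / ν) ^ γ)) := by gcongr
        _ = _ := by
            rw [Real.div_rpow (by norm_num) hνpos.le, Real.sqrt_eq_rpow, Real.rpow_neg hνpos.le,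
              Real.rpow_neg hνpos.le, hK]
            ring
    have hfin : ν ^ (-(γ + 3 / 2)) = ν ^ (-γ) * ν ^ (-(1 / 2) : ℝ) / ν := by
      rw [← Real.rpow_add hνpos, ← Real.rpow_sub_one hνpos.ne']
      congr 1; ring
    have h3 : |truncMoment γ (legendreP (m + 1)) t| ≤ K * ν ^ (-(γ + 3 / 2)) := by
      rw [hfin, ← mul_div_assoc, le_div_iff₀ hνpos]
      linarith
    exact h3.trans (mul_le_mul_of_nonneg_right (le_max_right _ _) (Real.rpow_nonneg hνpos.le _))
  | succ N ih =>
    rcases le_or_gt γ 1 with h0 | h0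
    · exact ih hγ (by linarith [N.cast_nonneg (α := ℝ)])
    · push_cast at hN
      obtain ⟨C, hC⟩ := ih (γ := γ - 1) (by linarith) (by linarith)
      obtain ⟨C', hC'⟩ := exists_truncMoment_legendreP_bound_succ hγ (by linarith) hC
      refine ⟨C', fun n t ht => ?_⟩
      convert hC' n t ht using 3
      ring

lemma truncMoment_X_sub_C_mul (γ : ℝ) (q : ℝ[X]) {t : ℝ} (ht : t ≤ 1) :
    truncMoment γ ((X - C t) * q) t = truncMoment (γ + 1) q t := by
  refine intervalIntegral.integral_congr_ae (ae_of_all _ fun x hx => ?_)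
  rw [uIoc_of_le ht] at hx
  rw [Real.rpow_add_one (by linarith [hx.1])]
  simp
  ring

lemma truncMoment_legendreP_neg_one_succ {γ : ℝ} (hγ : -1 < γ) (n : ℕ) :
    (γ + n + 2) * truncMoment γ (legendreP (n + 1)) (-1) =
      (γ - n) * truncMoment γ (legendreP n) (-1) := by
  have h := truncMoment_derivative (γ := γ + 1) (by linarith)
    (Q := legendreP n - legendreP (n + 1)) (by simp [legendreP_eval_one]) (t := -1) (by norm_num)
  have e : (X - C (-1 : ℝ)) * derivative (legendreP n - legendreP (n + 1)) =
      C (-((n : ℝ) + 1)) * (legendreP n + legendreP (n + 1)) := by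
    simp only [derivative_sub, C_neg, C_add, map_natCast, C_1]
    linear_combination -derivative_legendreP_succ n - X_mul_derivative_legendreP_succ n
  rw [← truncMoment_X_sub_C_mul γ _ (by norm_num), e, truncMoment_const_mul, truncMoment_add hγ,
    add_sub_cancel_right, truncMoment_sub hγ] at h
  linarith

lemma one_sub_mul_exp_two_mul_le {y : ℝ} (h0 : 0 ≤ y) (h1 : y < 1) :
    (1 - y) * Real.exp (2 * y) ≤ 1 + y := by
  have hs := Real.hasSum_log_sub_log_of_abs_lt_one (x := y) (by rwa [abs_of_nonneg h0])
  have h := le_hasSum hs 0 (fun k _ => by positivity)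
  simp at h
  have h2 : 2 * y ≤ Real.log ((1 + y) / (1 - y)) := by
    rw [Real.log_div (by linarith) (by linarith)]; exact h
  have h3 := Real.exp_le_exp.mpr h2
  rw [Real.exp_log (div_pos (by linarith) (by linarith)), le_div_iff₀ (by linarith)] at h3
  linarith

/-- The moments of `(1 + x)^γ` decay at the doubled rate `O(n^{-(2γ+2)})`. -/
lemma exists_truncMoment_legendreP_neg_one_bound {γ : ℝ} (hγ : -1 < γ) :
    ∃ C, ∀ n : ℕ, |truncMoment γ (legendreP n) (-1)| ≤ C * ((n : ℝ) + 1) ^ (-(2 * γ + 2)) := by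
  set u : ℕ → ℝ := fun n => |truncMoment γ (legendreP n) (-1)| * ((n : ℝ) + 1) ^ (2 * γ + 2) with hu
  have hu0 : ∀ n, 0 ≤ u n := fun n => by positivity
  obtain ⟨N, hN⟩ := exists_nat_gt γ
  have step : ∀ n, N ≤ n → u (n + 1) ≤ u n := by
    intro n hn
    have hnγ : γ < n := hN.trans_le (by exact_mod_cast hn)
    have hn0 : (0 : ℝ) ≤ n := n.cast_nonneg
    have hrec := congrArg abs (truncMoment_legendreP_neg_one_succ hγ n)
    rw [abs_mul, abs_mul, abs_of_pos (by linarith), abs_of_neg (by linarith : γ - n < 0)] at hrec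
    have hpos : (0 : ℝ) < n + 1 := by positivity
    have hratio : (((n + 1 : ℕ) : ℝ) + 1) ^ (2 * γ + 2) ≤
        Real.exp (2 * ((γ + 1) / (n + 1))) * ((n : ℝ) + 1) ^ (2 * γ + 2) := by
      have e1 : (((n + 1 : ℕ) : ℝ) + 1) = (1 / (n + 1) + 1) * ((n : ℝ) + 1) := by
        push_cast; field_simp; ring
      rw [e1, Real.mul_rpow (by positivity) hpos.le]
      gcongr
      calc (1 / ((n : ℝ) + 1) + 1) ^ (2 * γ + 2) ≤ (Real.exp (1 / (n + 1))) ^ (2 * γ + 2) :=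
            Real.rpow_le_rpow (by positivity) (Real.add_one_le_exp _) (by linarith)
        _ = Real.exp (2 * ((γ + 1) / (n + 1))) := by
            rw [← Real.exp_mul]; congr 1; ring
    have hy := one_sub_mul_exp_two_mul_le (y := (γ + 1) / (n + 1))
      (div_nonneg (by linarith) hpos.le) (by rw [div_lt_one hpos]; linarith)
    have hy' : (n - γ) * Real.exp (2 * ((γ + 1) / (n + 1))) ≤ γ + n + 2 := by
      have := mul_le_mul_of_nonneg_left hy hpos.le
      have e2 : ((n : ℝ) + 1) * ((1 - (γ + 1) / (n + 1)) * Real.exp (2 * ((γ + 1) / (n + 1)))) =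
          (n - γ) * Real.exp (2 * ((γ + 1) / (n + 1))) := by field_simp; ring
      have e3 : ((n : ℝ) + 1) * (1 + (γ + 1) / (n + 1)) = γ + n + 2 := by field_simp; ring
      rwa [e2, e3] at this
    have hq : 0 < γ + n + 2 := by linarith
    refine le_of_mul_le_mul_left ?_ hq
    calc (γ + n + 2) * u (n + 1)
        = (-(γ - n) * |truncMoment γ (legendreP n) (-1)|) *
            (((n + 1 : ℕ) : ℝ) + 1) ^ (2 * γ + 2) := by rw [← hrec]; simp only [hu]; ring
      _ ≤ (-(γ - n) * |truncMoment γ (legendreP n) (-1)|) *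
            (Real.exp (2 * ((γ + 1) / (n + 1))) * ((n : ℝ) + 1) ^ (2 * γ + 2)) := by
          refine mul_le_mul_of_nonneg_left hratio (mul_nonneg (by linarith) (abs_nonneg _))
      _ = ((n - γ) * Real.exp (2 * ((γ + 1) / (n + 1)))) * u n := by simp only [hu]; ring
      _ ≤ (γ + n + 2) * u n := mul_le_mul_of_nonneg_right hy' (hu0 n)
  have bound : ∀ n, u n ≤ ∑ j ∈ Finset.range (N + 1), u j := by
    intro n
    rcases le_total n N with h | h
    · exact Finset.single_le_sum (fun j _ => hu0 j) (Finset.mem_range.mpr (by omega))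
    · induction n, h using Nat.le_induction with
      | base => exact Finset.single_le_sum (fun j _ => hu0 j) (Finset.mem_range.mpr (by omega))
      | succ n hn ih => exact (step n hn).trans ih
  refine ⟨∑ j ∈ Finset.range (N + 1), u j, fun n => ?_⟩
  have hpos : (0 : ℝ) < n + 1 := by positivity
  rw [Real.rpow_neg hpos.le, ← div_eq_mul_inv, le_div_iff₀ (Real.rpow_pos_of_pos hpos _)]
  exact bound n

end MomentBounds

section RiemannLiouville

open Polynomial

lemma integral_beta_kernel {a b t x : ℝ} (ha : 0 < a) (hb : 0 < b) (htx : t < x) :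
    ∫ s in t..x, (x - s) ^ (a - 1) * (s - t) ^ (b - 1) =
      Real.Gamma a * Real.Gamma b / Real.Gamma (a + b) * (x - t) ^ (a + b - 1) := by
  have h0 : 0 < x - t := sub_pos.2 htx
  have h1 : ∫ s in t..x, (x - s) ^ (a - 1) * (s - t) ^ (b - 1) =
      ∫ s in (0:ℝ)..(x - t), s ^ (b - 1) * (x - t - s) ^ (a - 1) := by
    rw [← sub_self t, ← intervalIntegral.integral_comp_sub_right]
    refine intervalIntegral.integral_congr fun s _ => ?_
    rw [mul_comm, sub_sub_sub_cancel_right]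
  rw [h1]
  have h2 := Complex.betaIntegral_scaled (b : ℂ) (a : ℂ) h0
  rw [Complex.betaIntegral_eq_Gamma_mul_div _ _ (by simpa using hb) (by simpa using ha)] at h2
  have h3 : ∀ s ∈ uIcc 0 (x - t),
      ((s : ℂ) ^ ((b : ℂ) - 1) * (((x - t : ℝ) : ℂ) - s) ^ ((a : ℂ) - 1)) =
      ((s ^ (b - 1) * (x - t - s) ^ (a - 1) : ℝ) : ℂ) := by
    intro s hs
    rw [uIcc_of_le h0.le] at hs
    rw [Complex.ofReal_mul, Complex.ofReal_cpow hs.1, Complex.ofReal_cpow (by linarith [hs.2])]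
    push_cast
    rfl
  rw [intervalIntegral.integral_congr h3, intervalIntegral.integral_ofReal, ← Complex.ofReal_add,
    ← Complex.ofReal_one, ← Complex.ofReal_sub, ← Complex.ofReal_cpow h0.le, Complex.Gamma_ofReal,
    Complex.Gamma_ofReal, Complex.Gamma_ofReal] at h2
  norm_cast at h2
  rw [h2, add_comm b a]
  ring

lemma intervalIntegrable_beta_kernel {a b t x : ℝ} (ha : 0 < a) (hb : 0 < b) (htx : t < x) :
    IntervalIntegrable (fun s => (x - s) ^ (a - 1) * (s - t) ^ (b - 1)) volume t x := by
  refine intervalIntegral.intervalIntegrable_of_integral_ne_zero ?_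
  rw [integral_beta_kernel ha hb htx]
  have := Real.Gamma_pos_of_pos ha
  have := Real.Gamma_pos_of_pos hb
  have := Real.Gamma_pos_of_pos (add_pos ha hb)
  have := Real.rpow_pos_of_pos (sub_pos.2 htx) (a + b - 1)
  positivity

/-- The Riemann–Liouville fractional integral of order `a` based at `-1`. -/
noncomputable def riemannLiouville (a : ℝ) (f : ℝ → ℝ) (x : ℝ) : ℝ :=
  (1 / Real.Gamma a) * ∫ y in (-1)..x, (x - y) ^ (a - 1) * f y

lemma riemannLiouville_congr {a x : ℝ} {f g : ℝ → ℝ} (hx : -1 ≤ x)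
    (h : ∀ y ∈ Ioo (-1) x, f y = g y) : riemannLiouville a f x = riemannLiouville a g x := by
  unfold riemannLiouville
  congr 1
  rw [intervalIntegral.integral_of_le hx, intervalIntegral.integral_of_le hx,
    integral_Ioc_eq_integral_Ioo, integral_Ioc_eq_integral_Ioo]
  exact setIntegral_congr_fun measurableSet_Ioo fun y hy => by simp only [h y hy]

lemma riemannLiouville_rpow {a b x : ℝ} (ha : 0 < a) (hb : -1 < b) (hx : -1 < x) :
    riemannLiouville a (fun y => (y + 1) ^ b / Real.Gamma (b + 1)) x =
      (x + 1) ^ (b + a) / Real.Gamma (b + a + 1) := by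
  have h := integral_beta_kernel ha (show 0 < b + 1 by linarith) hx
  simp only [riemannLiouville, ← mul_div_assoc, intervalIntegral.integral_div]
  simp only [sub_neg_eq_add, add_sub_cancel_right] at h
  rw [h]
  have h1 := (Real.Gamma_pos_of_pos ha).ne'
  have h2 := (Real.Gamma_pos_of_pos (show 0 < b + 1 by linarith)).ne'
  have e1 : a + (b + 1) = b + a + 1 := by ring
  have e2 : a + (b + 1) - 1 = b + a := by ring
  rw [e2, e1]
  field_simp

lemma setIntegral_ite_lt_right {a s x : ℝ} (hs : s ∈ Ioc a x) (h : ℝ → ℝ) :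
    ∫ t in Ioc a x, (if t < s then h t else 0) = ∫ t in a..s, h t := by
  have h1 : (fun t => if t < s then h t else 0) = (Iio s).indicator h := by
    ext t; simp [indicator_apply]
  rw [h1, setIntegral_indicator measurableSet_Iio, intervalIntegral.integral_of_le hs.1.le,
    integral_Ioc_eq_integral_Ioo]
  congr 2
  ext t
  simp only [mem_inter_iff, mem_Ioc, mem_Iio, mem_Ioo]
  constructor
  · rintro ⟨⟨h1, h2⟩, h3⟩; exact ⟨h1, h3⟩
  · rintro ⟨h1, h2⟩; exact ⟨⟨h1, h2.le.trans hs.2⟩, h2⟩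

lemma setIntegral_ite_lt_left {a t x : ℝ} (ht : t ∈ Ioc a x) (h : ℝ → ℝ) :
    ∫ s in Ioc a x, (if t < s then h s else 0) = ∫ s in t..x, h s := by
  have h1 : (fun s => if t < s then h s else 0) = (Ioi t).indicator h := by
    ext t; simp [indicator_apply]
  rw [h1, setIntegral_indicator measurableSet_Ioi, intervalIntegral.integral_of_le ht.2]
  congr 2
  ext t
  simp only [mem_inter_iff, mem_Ioc, mem_Ioi]
  constructor
  · rintro ⟨⟨h1, h2⟩, h3⟩; exact ⟨h3, h2⟩
  · rintro ⟨h1, h2⟩; exact ⟨⟨ht.1.trans h1, h2⟩, h1⟩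

lemma integrable_beta_kernel_prod {a b x : ℝ} (ha : 0 < a) (hb : 0 < b) (hab : 1 ≤ a + b)
    {f : ℝ → ℝ} (hx : -1 < x) (hf : IntervalIntegrable f volume (-1) x) :
    Integrable (fun z : ℝ × ℝ => if z.2 < z.1 then
        (x - z.1) ^ (a - 1) * ((z.1 - z.2) ^ (b - 1) * f z.2) else 0)
      ((volume.restrict (Ioc (-1) x)).prod (volume.restrict (Ioc (-1) x))) := by
  have hf' : IntegrableOn f (Ioc (-1) x) :=
    (intervalIntegrable_iff_integrableOn_Ioc_of_le hx.le).1 hf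
  have hmeas : AEStronglyMeasurable (fun z : ℝ × ℝ => if z.2 < z.1 then
        (x - z.1) ^ (a - 1) * ((z.1 - z.2) ^ (b - 1) * f z.2) else 0)
      ((volume.restrict (Ioc (-1) x)).prod (volume.restrict (Ioc (-1) x))) := by
    have h1 : AEStronglyMeasurable
      (fun z : ℝ × ℝ => (x - z.1) ^ (a - 1) * ((z.1 - z.2) ^ (b - 1) * f z.2))
      ((volume.restrict (Ioc (-1) x)).prod (volume.restrict (Ioc (-1) x))) := by
      refine AEStronglyMeasurable.mul ?_ (AEStronglyMeasurable.mul ?_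
          hf'.aestronglyMeasurable.comp_snd)
      · exact Measurable.aestronglyMeasurable (by fun_prop)
      · exact Measurable.aestronglyMeasurable (by fun_prop)
    have h2 := h1.indicator (measurableSet_lt (measurable_snd (α := ℝ) (β := ℝ)) measurable_fst)
    refine h2.congr (Eventually.of_forall fun z => ?_)
    simp [indicator_apply]
  have hne : ∀ᵐ t ∂(volume.restrict (Ioc (-1) x)), t ∈ Ioc (-1) x ∧ t < x := by
    filter_upwards [ae_restrict_mem measurableSet_Ioc, ae_restrict_of_ae (Measure.ae_ne volume x)]
      with t ht htx
    exact ⟨ht, lt_of_le_of_ne ht.2 htx⟩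
  rw [integrable_prod_iff' hmeas]
  constructor
  · filter_upwards [hne] with t ⟨ht, htx⟩
    have h1 := (intervalIntegrable_iff_integrableOn_Ioc_of_le htx.le).1
      ((intervalIntegrable_beta_kernel ha hb htx).mul_const (f t))
    have h2 := (integrable_indicator_iff measurableSet_Ioc).2 h1
    refine (h2.integrableOn (s := Ioc (-1) x)).congr_fun (fun s hs => ?_) measurableSet_Ioc
    by_cases h : t < s
    · simp [h, hs.2, mul_assoc]
    · simp [h]
  · set B := Real.Gamma a * Real.Gamma b / Real.Gamma (a + b) with hB
    have h1 : Integrable (fun t => B * (x - t) ^ (a + b - 1) * |f t|)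
        (volume.restrict (Ioc (-1) x)) := by
      refine (intervalIntegrable_iff_integrableOn_Ioc_of_le hx.le).1 ?_
      refine hf.abs.continuousOn_mul (Continuous.continuousOn ?_)
      exact continuous_const.mul
        ((continuous_const.sub continuous_id).rpow_const fun _ => Or.inr (by linarith))
    refine h1.congr ?_
    filter_upwards [hne] with t ⟨ht, htx⟩
    have h2 : ∀ s ∈ Ioc (-1) x, ‖if t < s then
        (x - s) ^ (a - 1) * ((s - t) ^ (b - 1) * f t) else 0‖ =
        if t < s then (x - s) ^ (a - 1) * (s - t) ^ (b - 1) * |f t| else 0 := by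
      intro s hs
      split_ifs with h
      · rw [Real.norm_eq_abs, abs_mul, abs_mul,
          abs_of_nonneg (Real.rpow_nonneg (by linarith [hs.2]) _),
          abs_of_nonneg (Real.rpow_nonneg (by linarith) _), mul_assoc]
      · simp
    rw [setIntegral_congr_fun measurableSet_Ioc h2, setIntegral_ite_lt_left ht,
      intervalIntegral.integral_mul_const, integral_beta_kernel ha hb htx]

lemma riemannLiouville_kernel_intervalIntegrable {a b x : ℝ} (ha : 0 < a) (hb : 0 < b)
    (hab : 1 ≤ a + b) {f : ℝ → ℝ} (hx : -1 < x) (hf : IntervalIntegrable f volume (-1) x) :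
    IntervalIntegrable (fun s => (x - s) ^ (a - 1) * riemannLiouville b f s) volume (-1) x := by
  have h := (integrable_beta_kernel_prod ha hb hab hx hf).integral_prod_left
  refine (intervalIntegrable_iff_integrableOn_Ioc_of_le hx.le).2 ?_
  refine (h.const_mul (1 / Real.Gamma b)).congr ?_
  filter_upwards [ae_restrict_mem measurableSet_Ioc] with s hs
  rw [setIntegral_ite_lt_right hs, intervalIntegral.integral_const_mul, riemannLiouville]
  ring

/-- The semigroup property of Riemann–Liouville integrals. -/
lemma riemannLiouville_riemannLiouville {a b x : ℝ} (ha : 0 < a) (hb : 0 < b)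
    (hab : 1 ≤ a + b) {f : ℝ → ℝ} (hx : -1 < x) (hf : IntervalIntegrable f volume (-1) x) :
    riemannLiouville a (riemannLiouville b f) x = riemannLiouville (a + b) f x := by
  have h := integral_integral_swap (f := fun s t => if t < s then
        (x - s) ^ (a - 1) * ((s - t) ^ (b - 1) * f t) else 0)
            (integrable_beta_kernel_prod ha hb hab hx hf)
  have h1 : ∀ s ∈ Ioc (-1) x, (∫ t in Ioc (-1) x, if t < s then
        (x - s) ^ (a - 1) * ((s - t) ^ (b - 1) * f t) else 0) =
      Real.Gamma b * ((x - s) ^ (a - 1) * riemannLiouville b f s) := by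
    intro s hs
    have := (Real.Gamma_pos_of_pos hb).ne'
    rw [setIntegral_ite_lt_right hs, intervalIntegral.integral_const_mul, riemannLiouville]
    field_simp
  have h2 : ∀ t ∈ Ioo (-1) x, (∫ s in Ioc (-1) x, if t < s then
        (x - s) ^ (a - 1) * ((s - t) ^ (b - 1) * f t) else 0) =
      Real.Gamma a * Real.Gamma b / Real.Gamma (a + b) * ((x - t) ^ (a + b - 1) * f t) := by
    intro t ht
    simp only [← mul_assoc]
    rw [setIntegral_ite_lt_left ⟨ht.1, ht.2.le⟩, intervalIntegral.integral_mul_const,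
      integral_beta_kernel ha hb ht.2]
  have h3 : ∫ s in (-1)..x, (x - s) ^ (a - 1) * riemannLiouville b f s =
      Real.Gamma a / Real.Gamma (a + b) * ∫ t in (-1)..x, (x - t) ^ (a + b - 1) * f t := by
    have := (Real.Gamma_pos_of_pos hb).ne'
    rw [setIntegral_congr_fun measurableSet_Ioc h1, integral_const_mul] at h
    rw [integral_Ioc_eq_integral_Ioo, integral_Ioc_eq_integral_Ioo,
      setIntegral_congr_fun measurableSet_Ioo h2, integral_const_mul] at h
    rw [intervalIntegral.integral_of_le hx.le, intervalIntegral.integral_of_le hx.le,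
      integral_Ioc_eq_integral_Ioo, integral_Ioc_eq_integral_Ioo]
    refine mul_left_cancel₀ this (h.trans ?_)
    ring
  have := (Real.Gamma_pos_of_pos ha).ne'
  rw [riemannLiouville, h3, riemannLiouville]
  field_simp

lemma exists_eq_add_integral_of_hasDerivAt {f f' : ℝ → ℝ}
    (hf : ∀ x ∈ Ioo (-1 : ℝ) 1, HasDerivAt f (f' x) x)
    (hf' : IntervalIntegrable f' volume (-1) 1) :
    ∃ c, Tendsto f (nhdsWithin (-1) (Ioi (-1))) (nhds c) ∧
      ∀ x ∈ Ioo (-1 : ℝ) 1, f x = c + ∫ y in (-1)..x, f' y := by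
  have hint : ∀ x ∈ Icc (-1 : ℝ) 1, ∀ y ∈ Icc (-1 : ℝ) 1, IntervalIntegrable f' volume x y :=
    fun x hx y hy => hf'.mono_set (by
      rw [uIcc_of_le (show (-1 : ℝ) ≤ 1 by norm_num)]
      exact uIcc_subset_Icc hx hy)
  have h0 : (0 : ℝ) ∈ Icc (-1 : ℝ) 1 := by constructor <;> norm_num
  have hl : (-1 : ℝ) ∈ Icc (-1 : ℝ) 1 := by constructor <;> norm_num
  have heq : ∀ x ∈ Ioo (-1 : ℝ) 1,
      f x = (f 0 - ∫ y in (-1)..0, f' y) + ∫ y in (-1)..x, f' y := by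
    intro x hx
    have h1 := intervalIntegral.integral_eq_sub_of_hasDerivAt (a := 0) (b := x) (f := f) (f' := f')
      (fun y hy => hf y (by
        have h2 := (ordConnected_Ioo (a := (-1 : ℝ)) (b := 1)).uIcc_subset
          (show (0 : ℝ) ∈ Ioo (-1 : ℝ) 1 by constructor <;> norm_num) hx
        exact h2 hy)) (hint 0 h0 x ⟨hx.1.le, hx.2.le⟩)
    have h2 := intervalIntegral.integral_add_adjacent_intervals (hint (-1) hl 0 h0)
      (hint 0 h0 x ⟨hx.1.le, hx.2.le⟩)
    linarith
  refine ⟨_, ?_, heq⟩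
  have hc : ContinuousOn (fun x => (f 0 - ∫ y in (-1)..0, f' y) + ∫ y in (-1)..x, f' y)
      (uIcc (-1) 1) :=
    continuousOn_const.add (intervalIntegral.continuousOn_primitive_interval' hf' left_mem_uIcc)
  have h1 := (hc (-1) left_mem_uIcc).mono_left (nhdsWithin_mono (-1)
    (show Ioo (-1 : ℝ) 1 ⊆ uIcc (-1) 1 by
      rw [uIcc_of_le (show (-1 : ℝ) ≤ 1 by norm_num)]; exact Ioo_subset_Icc_self))
  simp only [intervalIntegral.integral_same, add_zero] at h1
  rw [nhdsWithin_Ioo_eq_nhdsGT (by norm_num)] at h1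
  refine h1.congr' ?_
  filter_upwards [Ioo_mem_nhdsGT (show (-1 : ℝ) < 1 by norm_num)] with x hx
  exact (heq x hx).symm

lemma riemannLiouville_one (f : ℝ → ℝ) (x : ℝ) :
    riemannLiouville 1 f x = ∫ y in (-1)..x, f y := by
  simp [riemannLiouville]

lemma riemannLiouville_const_add {a c x : ℝ} (ha : 0 < a) (hx : -1 < x) {h : ℝ → ℝ}
    (hh : IntervalIntegrable (fun y => (x - y) ^ (a - 1) * h y) volume (-1) x) :
    riemannLiouville a (fun y => c + h y) x =
      c * ((x + 1) ^ a / Real.Gamma (a + 1)) + riemannLiouville a h x := by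
  have h1 := riemannLiouville_rpow (a := a) (b := 0) ha (by norm_num) hx
  simp only [Real.rpow_zero, zero_add, Real.Gamma_one, div_one] at h1
  have h2 : IntervalIntegrable (fun y => (x - y) ^ (a - 1) * (1 : ℝ)) volume (-1) x := by
    have := intervalIntegrable_beta_kernel ha one_pos hx
    simpa using this
  rw [← h1]
  simp only [riemannLiouville]
  have h3 : ∀ y, (x - y) ^ (a - 1) * (c + h y) =
      c * ((x - y) ^ (a - 1) * 1) + (x - y) ^ (a - 1) * h y := fun y => by ring
  simp only [h3]
  rw [intervalIntegral.integral_add (h2.const_mul c) hh, intervalIntegral.integral_const_mul]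
  ring

/-- Taylor expansion of a Riemann–Liouville integral at the base point. -/
lemma riemannLiouville_taylor {a : ℝ} (ha : 0 < a) {g : ℕ → ℝ → ℝ} {c : ℕ → ℝ} {n : ℕ}
    (hg : ∀ i < n, ∀ x ∈ Ioo (-1 : ℝ) 1, HasDerivAt (g i) (g (i + 1) x) x)
    (hgi : ∀ i ≤ n, IntervalIntegrable (g i) volume (-1) 1)
    (hc : ∀ i < n, Tendsto (g i) (nhdsWithin (-1) (Ioi (-1))) (nhds (c i)))
    {x : ℝ} (hx : x ∈ Ioo (-1 : ℝ) 1) :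
    riemannLiouville a (g 0) x =
      ∑ i ∈ Finset.range n, c i * ((x + 1) ^ (a + i) / Real.Gamma (a + i + 1)) +
        riemannLiouville (a + n) (g n) x := by
  induction n with
  | zero => simp
  | succ n ih =>
    rw [ih (fun i hi => hg i (by omega)) (fun i hi => hgi i (by omega))
        (fun i hi => hc i (by omega)),
      Finset.sum_range_succ, add_assoc]
    congr 1
    have han : 0 < a + n := by positivity
    obtain ⟨d, hd, hd'⟩ := exists_eq_add_integral_of_hasDerivAt (hg n (by omega))
        (hgi (n + 1) le_rfl)
    obtain rfl := tendsto_nhds_unique (hc n (by omega)) hd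
    have hint : IntervalIntegrable (g (n + 1)) volume (-1) x := (hgi (n + 1) le_rfl).mono_set (by
      rw [uIcc_of_le (show (-1 : ℝ) ≤ 1 by norm_num), uIcc_of_le hx.1.le]
      exact Icc_subset_Icc_right hx.2.le)
    rw [riemannLiouville_congr hx.1.le (g := fun y => c n + riemannLiouville 1 (g (n + 1)) y)
      (fun y hy => by rw [riemannLiouville_one, hd' y ⟨hy.1, hy.2.trans hx.2⟩]),
      riemannLiouville_const_add han hx.1
        (riemannLiouville_kernel_intervalIntegrable han one_pos (by linarith) hx.1 hint),
      riemannLiouville_riemannLiouville han one_pos (by linarith) hx.1 hint]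
    push_cast
    rw [add_assoc a]

end RiemannLiouville

section RadauProjection

open Polynomial

lemma MemUL.eq_add_riemannLiouville {k m : ℕ} (hk : 1 ≤ k) {α : ℝ}
    (hα1 : (k : ℝ) - 1 < α) (hα2 : α < (k : ℝ)) {ω : ℝ → ℝ} {L : ℕ → ℝ} (h : MemUL k m α ω L) :
    ∃ q : ℝ[X], q.natDegree < k ∧ q.eval (-1) = ω (-1) ∧ ∀ x ∈ Ioo (-1 : ℝ) 1,
      ω x = q.eval x +
        ∑ i ∈ Finset.range m, L i * ((x + 1) ^ (α + i) / Real.Gamma (α + i + 1)) +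
        riemannLiouville (α + m) (iteratedDeriv m (caputoL k α (-1) ω)) x := by
  obtain ⟨hcont, hω, hωi, hG, hGi, hL⟩ := h
  have hk1 : (1 : ℝ) ≤ k := by exact_mod_cast hk
  have hα : 0 < α := by linarith
  have hlim : ∀ i : ℕ, ∃ c, i < k →
      Tendsto (iteratedDeriv i ω) (nhdsWithin (-1) (Ioi (-1))) (nhds c) ∧ ∀ x ∈ Ioo (-1 : ℝ) 1,
        iteratedDeriv i ω x = c + ∫ y in (-1)..x, iteratedDeriv (i + 1) ω y := by
    intro i
    by_cases hi : i < k
    · obtain ⟨c, hc⟩ := exists_eq_add_integral_of_hasDerivAt (hω i hi) (hωi (i + 1) hi)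
      exact ⟨c, fun _ => hc⟩
    · exact ⟨0, fun h => absurd h hi⟩
  choose c hc using hlim
  obtain ⟨n, rfl⟩ : ∃ n, k = n + 1 := ⟨k - 1, by omega⟩
  have hc0 : c 0 = ω (-1) := by
    refine tendsto_nhds_unique (hc 0 (by omega)).1 ?_
    have h1 := (hcont (-1) ⟨le_rfl, by norm_num⟩).mono_left
      (nhdsWithin_mono (-1) (Ioo_subset_Icc_self (a := (-1 : ℝ)) (b := 1)))
    rw [nhdsWithin_Ioo_eq_nhdsGT (by norm_num)] at h1
    simpa using h1
  refine ⟨C (ω (-1)) + ∑ i ∈ Finset.range n,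
    C (c (i + 1) / Real.Gamma (1 + i + 1)) * (X + C 1) ^ (i + 1),
    ?_, ?_, ?_⟩
  · refine Nat.lt_succ_of_le (natDegree_add_le_of_degree_le (by simp) ?_)
    refine natDegree_sum_le_of_forall_le _ _ fun i hi => ?_
    refine (natDegree_C_mul_le _ _).trans (natDegree_pow_le.trans ?_)
    rw [natDegree_X_add_C, mul_one]
    exact Finset.mem_range.1 hi
  · simp [eval_finsetSum]
  · intro x hx
    have hsub : uIcc (-1) x ⊆ uIcc (-1 : ℝ) 1 := by
      rw [uIcc_of_le (show (-1 : ℝ) ≤ 1 by norm_num), uIcc_of_le hx.1.le]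
      exact Icc_subset_Icc_right hx.2.le
    have h1 := (hc 0 (by omega)).2 x hx
    have h2 := riemannLiouville_taylor one_pos (g := fun i => iteratedDeriv (i + 1) ω)
      (c := fun i => c (i + 1)) (n := n) (fun i hi => hω (i + 1) (by omega))
      (fun i hi => hωi (i + 1) (by omega)) (fun i hi => (hc (i + 1) (by omega)).1) hx
    have h3 := riemannLiouville_taylor hα (g := fun i => iteratedDeriv i (caputoL (n + 1) α (-1) ω))
      hG hGi hL hx
    have h4 := riemannLiouville_riemannLiouville hα (sub_pos.2 hα2) (by linarith) hx.1
      ((hωi (n + 1) le_rfl).mono_set hsub)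
    have h5 : iteratedDeriv 0 (caputoL (n + 1) α (-1) ω) =
        riemannLiouville (((n + 1 : ℕ) : ℝ) - α) (iteratedDeriv (n + 1) ω) := by
      rw [iteratedDeriv_zero]
      rfl
    simp only [h5] at h3
    rw [h4] at h3
    rw [iteratedDeriv_zero, zero_add, ← riemannLiouville_one] at h1
    simp only [zero_add] at h2
    have e1 : (1 : ℝ) + n = α + (((n + 1 : ℕ) : ℝ) - α) := by push_cast; ring
    rw [h1, h2, e1, h3, hc0]
    simp only [eval_add, eval_C, eval_finsetSum, eval_mul, eval_pow, eval_X, ← add_assoc]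
    congr 3
    refine Finset.sum_congr rfl fun i _ => ?_
    rw [add_comm (1 : ℝ) i, ← Nat.cast_add_one, Real.rpow_natCast]
    ring

lemma integrable_sub_rpow_mul_prod {a : ℝ} (ha : 1 < a) {G : ℝ → ℝ}
    (hG : IntervalIntegrable G volume (-1) 1) (R : ℝ[X]) :
    Integrable (fun z : ℝ × ℝ => if z.2 < z.1 then
        (z.1 - z.2) ^ (a - 1) * G z.2 * R.eval z.1 else 0)
      ((volume.restrict (Ioc (-1) 1)).prod (volume.restrict (Ioc (-1) 1))) := by
  have hG' : IntegrableOn G (Ioc (-1) 1) :=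
    (intervalIntegrable_iff_integrableOn_Ioc_of_le (by norm_num)).1 hG
  have hcont : Continuous fun z : ℝ × ℝ => (max (z.1 - z.2) 0) ^ (a - 1) * R.eval z.1 :=
    (((continuous_fst.sub continuous_snd).max continuous_const).rpow_const
      fun _ => Or.inr (by linarith)).mul (R.continuous.comp continuous_fst)
  obtain ⟨M, hM⟩ := ((isCompact_Icc (a := (-1 : ℝ)) (b := 1)).prod
    (isCompact_Icc (a := (-1 : ℝ)) (b := 1))).exists_bound_of_continuousOn hcont.continuousOn
  have h1 := (hG'.comp_snd (volume.restrict (Ioc (-1) 1))).bdd_mul (c := M)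
    hcont.aestronglyMeasurable (by
      rw [Measure.prod_restrict]
      filter_upwards [ae_restrict_mem (measurableSet_Ioc.prod measurableSet_Ioc)] with z hz
      exact hM z ⟨Ioc_subset_Icc_self hz.1, Ioc_subset_Icc_self hz.2⟩)
  refine h1.congr (Eventually.of_forall fun z => ?_)
  simp only
  split_ifs with h
  · rw [max_eq_left (sub_pos.2 h).le]
    ring
  · rw [max_eq_right (by linarith), Real.zero_rpow (by linarith)]
    ring

lemma riemannLiouville_mul_intervalIntegrable {a : ℝ} (ha : 1 < a) {G : ℝ → ℝ}
    (hG : IntervalIntegrable G volume (-1) 1) (R : ℝ[X]) :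
    IntervalIntegrable (fun x => riemannLiouville a G x * R.eval x) volume (-1) 1 := by
  have h := (integrable_sub_rpow_mul_prod ha hG R).integral_prod_left
  refine (intervalIntegrable_iff_integrableOn_Ioc_of_le (by norm_num)).2 ?_
  refine (h.const_mul (1 / Real.Gamma a)).congr ?_
  filter_upwards [ae_restrict_mem measurableSet_Ioc] with x hx
  rw [setIntegral_ite_lt_right hx, intervalIntegral.integral_mul_const, riemannLiouville]
  ring

lemma integral_riemannLiouville_mul {a : ℝ} (ha : 1 < a) {G : ℝ → ℝ}
    (hG : IntervalIntegrable G volume (-1) 1) (R : ℝ[X]) :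
    ∫ x in (-1)..1, riemannLiouville a G x * R.eval x =
      (1 / Real.Gamma a) * ∫ t in (-1)..1, G t * truncMoment (a - 1) R t := by
  have h := integral_integral_swap (f := fun x t => if t < x then
        (x - t) ^ (a - 1) * G t * R.eval x else 0) (integrable_sub_rpow_mul_prod ha hG R)
  have h1 : ∀ x ∈ Ioc (-1 : ℝ) 1, (∫ t in Ioc (-1) 1, if t < x then
        (x - t) ^ (a - 1) * G t * R.eval x else 0) =
      Real.Gamma a * (riemannLiouville a G x * R.eval x) := by
    intro x hx
    have := (Real.Gamma_pos_of_pos (show 0 < a by linarith)).ne'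
    rw [setIntegral_ite_lt_right hx, intervalIntegral.integral_mul_const, riemannLiouville]
    field_simp
  have h2 : ∀ t ∈ Ioc (-1 : ℝ) 1, (∫ x in Ioc (-1) 1, if t < x then
        (x - t) ^ (a - 1) * G t * R.eval x else 0) = G t * truncMoment (a - 1) R t := by
    intro t ht
    rw [setIntegral_ite_lt_left ht, truncMoment, ← intervalIntegral.integral_const_mul]
    refine intervalIntegral.integral_congr fun x _ => ?_
    ring
  rw [setIntegral_congr_fun measurableSet_Ioc h1, setIntegral_congr_fun measurableSet_Ioc h2,
    integral_const_mul] at h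
  have := (Real.Gamma_pos_of_pos (show 0 < a by linarith)).ne'
  rw [intervalIntegral.integral_of_le (by norm_num),
      intervalIntegral.integral_of_le (by norm_num), ← h]
  field_simp

lemma truncMoment_neg_one (γ : ℝ) (R : ℝ[X]) :
    truncMoment γ R (-1) = ∫ x in (-1)..1, (x + 1) ^ γ * R.eval x := by
  simp [truncMoment]

/-- Up to a polynomial part, the moments of a function in the space are controlled by truncated
moments of the test polynomial. -/
lemma MemUL.exists_abs_integral_mul_sub_le {k m : ℕ} (hk : 1 ≤ k) (hm : 1 ≤ m) {α : ℝ}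
    (hα1 : (k : ℝ) - 1 < α) (hα2 : α < (k : ℝ)) {ω : ℝ → ℝ} {L : ℕ → ℝ} (h : MemUL k m α ω L) :
    ∃ q : ℝ[X], q.natDegree < k ∧ q.eval (-1) = ω (-1) ∧ ∀ (R : ℝ[X]) (A : ℝ),
      (∀ i < m, |truncMoment (α + i) R (-1)| ≤ A * Real.Gamma (α + i + 1)) →
      (∀ t ∈ Icc (-1 : ℝ) 1, |truncMoment (α + m - 1) R t| ≤ A * Real.Gamma (α + m)) →
      |(∫ x in (-1)..1, ω x * R.eval x) - ∫ x in (-1)..1, q.eval x * R.eval x| ≤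
        A * UsemiL k m α ω L := by
  obtain ⟨q, hq, hq1, hrep⟩ := h.eq_add_riemannLiouville hk hα1 hα2
  refine ⟨q, hq, hq1, fun R A hA hB => ?_⟩
  have hk1 : (1 : ℝ) ≤ k := by exact_mod_cast hk
  have hm1 : (1 : ℝ) ≤ m := by exact_mod_cast hm
  have hα : 0 < α := by linarith
  have ham : 1 < α + m := by linarith
  set G := iteratedDeriv m (caputoL k α (-1) ω) with hGdef
  have hG : IntervalIntegrable G volume (-1) 1 := h.2.2.2.2.1 m le_rfl
  have hint : ∀ i : ℕ,
      IntervalIntegrable (fun x => (x + 1) ^ (α + i) * R.eval x) volume (-1) 1 := by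
    intro i
    have := intervalIntegrable_sub_rpow_mul (γ := α + i)
      (by have := i.cast_nonneg (α := ℝ); linarith)
      R (-1) (-1) 1
    simpa using this
  have h1 : ∫ x in (-1)..1, ω x * R.eval x = ∫ x in (-1)..1,
      (q.eval x * R.eval x + ∑ i ∈ Finset.range m, L i / Real.Gamma (α + i + 1) *
        ((x + 1) ^ (α + i) * R.eval x)) + riemannLiouville (α + m) G x * R.eval x := by
    rw [intervalIntegral.integral_of_le (by norm_num),
        intervalIntegral.integral_of_le (by norm_num),
      integral_Ioc_eq_integral_Ioo, integral_Ioc_eq_integral_Ioo]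
    refine setIntegral_congr_fun measurableSet_Ioo fun x hx => ?_
    rw [hrep x hx, add_mul, add_mul, Finset.sum_mul]
    congr 2
    refine Finset.sum_congr rfl fun i _ => ?_
    ring
  have hintq : IntervalIntegrable (fun x => q.eval x * R.eval x) volume (-1) 1 :=
    (q.continuous.mul R.continuous).intervalIntegrable _ _
  have hintS : IntervalIntegrable (fun x => ∑ i ∈ Finset.range m, L i / Real.Gamma (α + i + 1) *
        ((x + 1) ^ (α + i) * R.eval x)) volume (-1) 1 := by
    have := IntervalIntegrable.sum (Finset.range m)
      (f := fun i x => L i / Real.Gamma (α + i + 1) * ((x + 1) ^ (α + i) * R.eval x))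
      (fun i _ => (hint i).const_mul _)
    simpa only [Finset.sum_fn] using this
  have h2 : (∫ x in (-1)..1, ω x * R.eval x) - ∫ x in (-1)..1, q.eval x * R.eval x =
      ∑ i ∈ Finset.range m, L i / Real.Gamma (α + i + 1) * truncMoment (α + i) R (-1) +
        (1 / Real.Gamma (α + m)) * ∫ t in (-1)..1, G t * truncMoment (α + m - 1) R t := by
    rw [h1, intervalIntegral.integral_add (hintq.add hintS)
      (riemannLiouville_mul_intervalIntegrable ham hG R), intervalIntegral.integral_add hintq hintS,
      intervalIntegral.integral_finsetSum (fun i _ => (hint i).const_mul _),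
      integral_riemannLiouville_mul ham hG]
    simp only [intervalIntegral.integral_const_mul, truncMoment_neg_one]
    ring
  rw [h2, UsemiL, mul_add, add_comm]
  refine (abs_add_le _ _).trans (add_le_add ?_ ?_)
  · have hΓ := Real.Gamma_pos_of_pos (show 0 < α + m by linarith)
    have h3 : |∫ t in (-1)..1, G t * truncMoment (α + m - 1) R t| ≤
        ∫ t in (-1)..1, A * Real.Gamma (α + m) * |G t| := by
      refine intervalIntegral.norm_integral_le_of_norm_le
        (f := fun t => G t * truncMoment (α + m - 1) R t)
        (by norm_num) (Eventually.of_forall fun t ht => ?_) (hG.abs.const_mul _)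
      rw [Real.norm_eq_abs, abs_mul, mul_comm]
      exact mul_le_mul_of_nonneg_right (hB t (Ioc_subset_Icc_self ht)) (abs_nonneg _)
    rw [intervalIntegral.integral_const_mul] at h3
    rw [abs_mul, abs_of_pos (by positivity), one_div, inv_mul_le_iff₀ hΓ]
    linarith
  · rw [Finset.mul_sum]
    refine (Finset.abs_sum_le_sum_abs _ _).trans (Finset.sum_le_sum fun i hi => ?_)
    have hΓ := Real.Gamma_pos_of_pos (show 0 < α + i + 1 by positivity)
    rw [abs_mul, abs_div, abs_of_pos hΓ, div_mul_eq_mul_div, div_le_iff₀ hΓ]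
    have := mul_le_mul_of_nonneg_left (hA i (Finset.mem_range.1 hi)) (abs_nonneg (L i))
    linarith

/-- The polynomials `P_{n+1} - P_n`, which vanish at `1`. -/
noncomputable def radauD (n : ℕ) : ℝ[X] := legendreP (n + 1) - legendreP n

lemma radauD_eval_one (n : ℕ) : (radauD n).eval 1 = 0 := by
  simp [radauD, legendreP_eval_one]

lemma derivative_radauD_succ (n : ℕ) :
    derivative (radauD (n + 1)) =
      C (2 * ((n : ℝ) + 1) + 1) * legendreP (n + 1) +
        (derivative (legendreP n) - derivative (legendreP (n + 1))) := by
  have h1 := derivative_legendreP_succ (n + 1)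
  have h2 := X_mul_derivative_legendreP_succ n
  rw [radauD, derivative_sub, h1, sub_eq_iff_eq_add.1 h2]
  simp only [C_add, C_mul, map_natCast, map_ofNat, map_one]
  push_cast
  ring

lemma integral_eval_mul_derivative_radauD {v : ℝ[X]} {n : ℕ} (hn : 1 ≤ n) (hv : v.natDegree ≤ n) :
    ∫ x in (-1 : ℝ)..1, v.eval x * (derivative (radauD n)).eval x =
      -(v.eval (-1) * (radauD n).eval (-1)) := by
  have hd := (natDegree_derivative_le v).trans_lt (show v.natDegree - 1 < n by omega)
  rw [integral_eval_mul_eval_derivative, radauD_eval_one]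
  have h1 : ∫ x in (-1 : ℝ)..1, (derivative v).eval x * (radauD n).eval x = 0 := by
    have hint : ∀ j, IntervalIntegrable
        (fun x => (derivative v).eval x * (legendreP j).eval x) volume (-1) 1 := fun j =>
      ((derivative v).continuous.mul (legendreP j).continuous).intervalIntegrable _ _
    simp only [radauD, eval_sub, mul_sub]
    rw [intervalIntegral.integral_sub (hint _) (hint _),
      integral_eval_mul_legendreP_eq_zero hd, integral_eval_mul_legendreP_eq_zero (by omega),
          sub_zero]
  rw [h1]
  ring

lemma add_one_rpow_le {r r' : ℝ} (h : r ≤ r') (n : ℕ) :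
    ((n : ℝ) + 1) ^ r ≤ ((n : ℝ) + 1) ^ r' :=
  Real.rpow_le_rpow_of_exponent_le (by have := n.cast_nonneg (α := ℝ); linarith) h

lemma exists_truncMoment_derivative_radauD_bound {γ : ℝ} (hγ : 0 < γ) :
    ∃ C, ∀ (n : ℕ), ∀ t ∈ Icc (-1 : ℝ) 1,
      |truncMoment γ (derivative (radauD n)) t| ≤ C * ((n : ℝ) + 1) ^ (-γ) := by
  obtain ⟨C, hC⟩ := exists_truncMoment_legendreP_bound (show -1 < γ - 1 by linarith)
  have hC0 : 0 ≤ C := by simpa using (abs_nonneg _).trans (hC 0 1 (by constructor <;> norm_num))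
  refine ⟨γ * (2 * C), fun n t ht => ?_⟩
  rw [truncMoment_derivative hγ (radauD_eval_one n) ht.2, abs_mul, abs_neg, abs_of_pos hγ,
      mul_assoc,
    radauD, truncMoment_sub (by linarith)]
  refine mul_le_mul_of_nonneg_left ?_ hγ.le
  have h1 := hC n t ht
  have h2 := hC (n + 1) t ht
  have h3 : (((n + 1 : ℕ) : ℝ) + 1) ^ (-(γ - 1 + 1)) ≤ ((n : ℝ) + 1) ^ (-(γ - 1 + 1)) :=
    Real.rpow_le_rpow_of_nonpos (by positivity) (by push_cast; linarith) (by linarith)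
  have h4 := mul_le_mul_of_nonneg_left h3 hC0
  rw [sub_add_cancel] at h1 h2 h4
  linarith [abs_sub (truncMoment (γ - 1) (legendreP (n + 1)) t)
      (truncMoment (γ - 1) (legendreP n) t)]

lemma exists_truncMoment_derivative_radauD_neg_one_bound {γ : ℝ} (hγ : 0 < γ) :
    ∃ C, ∀ n : ℕ,
      |truncMoment γ (derivative (radauD n)) (-1)| ≤ C * ((n : ℝ) + 1) ^ (-(2 * γ)) := by
  obtain ⟨C, hC⟩ := exists_truncMoment_legendreP_neg_one_bound (show -1 < γ - 1 by linarith)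
  have hC0 : 0 ≤ C := by simpa using (abs_nonneg _).trans (hC 0)
  refine ⟨γ * (2 * C), fun n => ?_⟩
  rw [truncMoment_derivative hγ (radauD_eval_one n) (by norm_num), abs_mul, abs_neg, abs_of_pos hγ,
    mul_assoc, radauD, truncMoment_sub (by linarith)]
  refine mul_le_mul_of_nonneg_left ?_ hγ.le
  have h1 := hC n
  have h2 := hC (n + 1)
  have h3 : (((n + 1 : ℕ) : ℝ) + 1) ^ (-(2 * (γ - 1) + 2)) ≤ ((n : ℝ) + 1) ^ (-(2 * (γ - 1) + 2)) :=
    Real.rpow_le_rpow_of_nonpos (by positivity) (by push_cast; linarith) (by linarith)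
  have h4 := mul_le_mul_of_nonneg_left h3 hC0
  rw [show 2 * (γ - 1) + 2 = 2 * γ by ring] at h1 h2 h4
  linarith [abs_sub (truncMoment (γ - 1) (legendreP (n + 1)) (-1))
    (truncMoment (γ - 1) (legendreP n) (-1))]

/-- Decay rates of truncated moments of a family of polynomials, with a common constant. -/
lemma exists_uniform_truncMoment_bound {α : ℝ} {m : ℕ} (hα : 0 < α) {r : ℝ} (R : ℕ → ℝ[X])
    (h1 : ∀ i : ℕ, ∃ C, ∃ r' ≤ r, ∀ n : ℕ,
      |truncMoment (α + i) (R n) (-1)| ≤ C * ((n : ℝ) + 1) ^ r')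
    (h2 : ∃ C, ∃ r' ≤ r, ∀ n : ℕ, ∀ t ∈ Icc (-1 : ℝ) 1,
      |truncMoment (α + m - 1) (R n) t| ≤ C * ((n : ℝ) + 1) ^ r') :
    ∃ A, ∀ n : ℕ, ∀ A' ≥ A,
      (∀ i < m, |truncMoment (α + i) (R n) (-1)| ≤
        A' * ((n : ℝ) + 1) ^ r * Real.Gamma (α + i + 1)) ∧
      ∀ t ∈ Icc (-1 : ℝ) 1, |truncMoment (α + m - 1) (R n) t| ≤
        A' * ((n : ℝ) + 1) ^ r * Real.Gamma (α + m) := by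
  have key : ∀ {C c r' A Γ : ℝ} {n : ℕ}, c ≤ C * ((n : ℝ) + 1) ^ r' → r' ≤ r → 0 < Γ →
      |C| / Γ ≤ A → c ≤ A * ((n : ℝ) + 1) ^ r * Γ := by
    intro C c r' A Γ n hc hr hΓ hA
    rw [div_le_iff₀ hΓ] at hA
    calc c ≤ C * ((n : ℝ) + 1) ^ r' := hc
      _ ≤ |C| * ((n : ℝ) + 1) ^ r' := by gcongr; exact le_abs_self C
      _ ≤ |C| * ((n : ℝ) + 1) ^ r := mul_le_mul_of_nonneg_left (add_one_rpow_le hr n) (abs_nonneg C)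
      _ ≤ (A * Γ) * ((n : ℝ) + 1) ^ r := by gcongr
      _ = A * ((n : ℝ) + 1) ^ r * Γ := by ring
  choose C r' hr' hC using h1
  obtain ⟨D, s', hs', hD⟩ := h2
  have hΓ : ∀ i : ℕ, 0 < Real.Gamma (α + i + 1) := fun i => Real.Gamma_pos_of_pos (by positivity)
  have hΓm : 0 < Real.Gamma (α + m) := Real.Gamma_pos_of_pos (by positivity)
  have hnn : ∀ i ∈ Finset.range m, 0 ≤ |C i| / Real.Gamma (α + i + 1) :=
    fun i _ => div_nonneg (abs_nonneg _) (hΓ i).le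
  have hDn : 0 ≤ |D| / Real.Gamma (α + m) := by positivity
  refine ⟨∑ i ∈ Finset.range m, |C i| / Real.Gamma (α + i + 1) + |D| / Real.Gamma (α + m),
    fun n A' hA' => ⟨fun i hi => ?_, fun t ht => ?_⟩⟩
  · refine key (hC i n) (hr' i) (hΓ i) ?_
    linarith [Finset.single_le_sum hnn (Finset.mem_range.2 hi)]
  · exact key (hD n t ht) hs' hΓm (by linarith [Finset.sum_nonneg hnn])

lemma mul_add_one_rpow_le_sub {r : ℝ} (hr : 0 < r) {x : ℝ} (hx : 0 < x) :
    r * (x + 1) ^ (-r - 1) ≤ x ^ (-r) - (x + 1) ^ (-r) := by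
  have hy : 0 < x + 1 := by linarith
  have h1 : x ^ (-r) = (x + 1) ^ (-r) * (x / (x + 1)) ^ (-r) := by
    rw [← Real.mul_rpow hy.le (by positivity), mul_div_cancel₀ _ hy.ne']
  have h2 : 1 + r / (x + 1) ≤ (x / (x + 1)) ^ (-r) := by
    rw [Real.rpow_def_of_pos (by positivity)]
    have h3 := Real.add_one_le_exp (Real.log (x / (x + 1)) * -r)
    have h4 := Real.log_le_sub_one_of_pos (show 0 < x / (x + 1) by positivity)
    have h5 : x / (x + 1) - 1 = -(1 / (x + 1)) := by field_simp; ring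
    have h6 : r / (x + 1) = r * (1 / (x + 1)) := by ring
    rw [h5] at h4
    nlinarith
  have h3 := mul_le_mul_of_nonneg_left h2 (Real.rpow_pos_of_pos hy (-r)).le
  rw [Real.rpow_sub_one hy.ne', h1]
  have h4 : r * ((x + 1) ^ (-r) / (x + 1)) = (x + 1) ^ (-r) * (r / (x + 1)) := by ring
  rw [h4]
  linarith

lemma sum_Ico_add_one_rpow_le {r : ℝ} (hr : 0 < r) (p N : ℕ) (hN : p + 1 ≤ N) :
    ∑ n ∈ Finset.Ico (p + 1) N, ((n : ℝ) + 1) ^ (-r - 1) ≤ ((p : ℝ) + 1) ^ (-r) / r := by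
  have h : r * ∑ n ∈ Finset.Ico (p + 1) N, ((n : ℝ) + 1) ^ (-r - 1) ≤
      ((p : ℝ) + 1) ^ (-r) - (N : ℝ) ^ (-r) := by
    induction N, hN using Nat.le_induction with
    | base => simp
    | succ N hN ih =>
      rw [Finset.sum_Ico_succ_top hN, mul_add]
      have := mul_add_one_rpow_le_sub hr (x := N) (by exact_mod_cast (by omega : 0 < N))
      push_cast
      linarith
  rw [le_div_iff₀ hr]
  have : 0 ≤ (N : ℝ) ^ (-r) := by positivity
  linarith

/-- Summation of Legendre coefficients that vanish below `p` and decay above it. -/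
lemma sum_sq_le_of_coeff_decay {s M : ℝ} (hs : 0 < s) {p : ℕ} {e : ℕ → ℝ}
    (h1 : ∀ n < p, e n = 0) (h2 : |e p| ≤ M * ((p : ℝ) + 1) ^ (-(s + 1 / 2)))
    (h3 : ∀ n > p, |e n| ≤ M * ((n : ℝ) + 1) ^ (-(s + 1))) (S : Finset ℕ) :
    ∑ n ∈ S, (2 * (n : ℝ) + 1) / 2 * e n ^ 2 ≤
      M ^ 2 * (1 + 1 / (2 * s)) * ((p : ℝ) + 1) ^ (-(2 * s)) := by
  have hsq : ∀ {r : ℝ} {n : ℕ}, |e n| ≤ M * ((n : ℝ) + 1) ^ (-r) →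
      (2 * (n : ℝ) + 1) / 2 * e n ^ 2 ≤ M ^ 2 * ((n : ℝ) + 1) ^ (1 - 2 * r) := by
    intro r n h
    have hn : (0 : ℝ) < (n : ℝ) + 1 := by positivity
    have h4 : e n ^ 2 ≤ (M * ((n : ℝ) + 1) ^ (-r)) ^ 2 := by
      rw [← sq_abs]
      exact pow_le_pow_left₀ (abs_nonneg _) h 2
    have h5 : ((n : ℝ) + 1) ^ (1 - 2 * r) = ((n : ℝ) + 1) * (((n : ℝ) + 1) ^ (-r)) ^ 2 := by
      rw [← Real.rpow_natCast (((n : ℝ) + 1) ^ (-r)) 2, ← Real.rpow_mul hn.le,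
        sub_eq_add_neg, Real.rpow_add hn, Real.rpow_one]
      congr 2
      push_cast
      ring
    rw [h5]
    calc (2 * (n : ℝ) + 1) / 2 * e n ^ 2 ≤ ((n : ℝ) + 1) * e n ^ 2 := by
          gcongr; linarith
      _ ≤ ((n : ℝ) + 1) * (M * ((n : ℝ) + 1) ^ (-r)) ^ 2 := by gcongr
      _ = _ := by ring
  obtain ⟨N, hN⟩ := S.exists_nat_subset_range
  have hsub : S ⊆ Finset.range (N + p + 1) := hN.trans (Finset.range_subset_range.2 (by omega))
  refine (Finset.sum_le_sum_of_subset_of_nonneg hsub fun n _ _ => by positivity).trans ?_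
  rw [← Finset.sum_range_add_sum_Ico _ (show p + 1 ≤ N + p + 1 by omega), Finset.sum_range_succ,
    Finset.sum_eq_zero fun n hn => by rw [h1 n (Finset.mem_range.1 hn)]; ring]
  have h4 := hsq h2
  have h5 : ∑ n ∈ Finset.Ico (p + 1) (N + p + 1), (2 * (n : ℝ) + 1) / 2 * e n ^ 2 ≤
      ∑ n ∈ Finset.Ico (p + 1) (N + p + 1), M ^ 2 * ((n : ℝ) + 1) ^ (-(2 * s) - 1) := by
    refine Finset.sum_le_sum fun n hn => ?_
    have h6 := hsq (h3 n (Finset.mem_Ico.1 hn).1)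
    rwa [show 1 - 2 * (s + 1) = -(2 * s) - 1 by ring] at h6
  rw [← Finset.mul_sum] at h5
  have h6 := mul_le_mul_of_nonneg_left
    (sum_Ico_add_one_rpow_le (show 0 < 2 * s by linarith) p (N + p + 1) (by omega)) (sq_nonneg M)
  rw [show 1 - 2 * (s + 1 / 2) = -(2 * s) by ring] at h4
  have h7 : M ^ 2 * (1 + 1 / (2 * s)) * ((p : ℝ) + 1) ^ (-(2 * s)) =
      M ^ 2 * ((p : ℝ) + 1) ^ (-(2 * s)) + M ^ 2 * (((p : ℝ) + 1) ^ (-(2 * s)) / (2 * s)) := by ring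
  rw [h7]
  linarith

end RadauProjection

/-- optimal `L²` estimate for the Gauss–Radau projection `Π_p^+`
of `ω ∈ 𝒰^{α,m}_{−1+}((−1,1))`. -/
theorem stmt_9 (k m : ℕ) (hk : 1 ≤ k) (hm : 1 ≤ m) (α : ℝ)
    (hα1 : (k : ℝ) - 1 < α) (hα2 : α < (k : ℝ)) (hαint : ∀ j : ℤ, α ≠ (j : ℝ))
    (hαm : 1 / 2 < α + (m : ℝ)) :
    ∃ C > (0 : ℝ), ∀ p : ℕ, α + (m : ℝ) < (p : ℝ) + 1 →
      ∀ (ω : ℝ → ℝ) (L : ℕ → ℝ), MemUL k m α ω L →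
        ∀ P : Polynomial ℝ, P.natDegree ≤ p →
          (∀ v : Polynomial ℝ, v.natDegree < p →
              ∫ x in (-1 : ℝ)..1, (P.eval x - ω x) * v.eval x = 0) →
          P.eval (-1) = ω (-1) →
          Real.sqrt (∫ x in (-1 : ℝ)..1, (ω x - P.eval x) ^ 2) ≤
            C * (p : ℝ) ^ (-(min (2 * α + 1 / 2) (α + (m : ℝ) - 1 / 2))) *
              UsemiL k m α ω L := by
  have hk1 : (1 : ℝ) ≤ k := by exact_mod_cast hk
  have hm1 : (1 : ℝ) ≤ m := by exact_mod_cast hm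
  have hα : 0 < α := by linarith
  set s := min (2 * α + 1 / 2) (α + (m : ℝ) - 1 / 2) with hsdef
  have hs1 : s ≤ 2 * α + 1 / 2 := min_le_left _ _
  have hs2 : s ≤ α + m - 1 / 2 := min_le_right _ _
  have hs : 0 < s := lt_min (by linarith) (by linarith)
  obtain ⟨A₁, hA₁⟩ := exists_uniform_truncMoment_bound (m := m) hα (r := -(s + 1)) legendreP
    (fun i => by
      have hi : (0 : ℝ) ≤ i := i.cast_nonneg
      obtain ⟨C, hC⟩ := exists_truncMoment_legendreP_neg_one_bound (show -1 < α + i by linarith)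
      exact ⟨C, _, by linarith, hC⟩)
    (by
      obtain ⟨C, hC⟩ := exists_truncMoment_legendreP_bound_of_pos (show 0 < α + m - 1 by linarith)
      exact ⟨C, _, by linarith, hC⟩)
  obtain ⟨A₂, hA₂⟩ := exists_uniform_truncMoment_bound (m := m) hα (r := -(s - 1 / 2))
    (fun n => Polynomial.derivative (radauD n))
    (fun i => by
      have hi : (0 : ℝ) ≤ i := i.cast_nonneg
      obtain ⟨C, hC⟩ := exists_truncMoment_derivative_radauD_neg_one_bound
        (show 0 < α + i by linarith)
      exact ⟨C, _, by linarith, hC⟩)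
    (by
      obtain ⟨C, hC⟩ := exists_truncMoment_derivative_radauD_bound (show 0 < α + m - 1 by linarith)
      exact ⟨C, _, by linarith, hC⟩)
  set A := max (max A₁ A₂) 1 with hA
  have hA1 : A₁ ≤ A := (le_max_left _ _).trans (le_max_left _ _)
  have hA2 : A₂ ≤ A := (le_max_right _ _).trans (le_max_left _ _)
  have hA0 : 0 < A := one_pos.trans_le (le_max_right _ _)
  refine ⟨A * Real.sqrt (1 + 1 / (2 * s)), by positivity, ?_⟩
  intro p hp ω L hω P hP horth hP1
  have hkp : k ≤ p := by
    have : (k : ℝ) < p + 1 := by linarith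
    exact Nat.lt_succ_iff.1 (by exact_mod_cast this)
  set U := UsemiL k m α ω L with hU
  have hU0 : 0 ≤ U := add_nonneg
    (intervalIntegral.integral_nonneg (by norm_num) fun _ _ => abs_nonneg _)
    (Finset.sum_nonneg fun _ _ => abs_nonneg _)
  obtain ⟨q, hq, hq1, hpair⟩ := hω.exists_abs_integral_mul_sub_le hk hm hα1 hα2
  have hintω : ∀ R : Polynomial ℝ, IntervalIntegrable (fun x => ω x * R.eval x) volume (-1) 1 :=
    fun R => ContinuousOn.intervalIntegrable_of_Icc (by norm_num)
        (hω.1.mul R.continuous.continuousOn)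
  have hintP : ∀ R : Polynomial ℝ,
      IntervalIntegrable (fun x => P.eval x * R.eval x) volume (-1) 1 :=
    fun R => (P.continuous.mul R.continuous).intervalIntegrable _ _
  have hE : ∀ R : Polynomial ℝ, ∫ x in (-1)..1, (ω x - P.eval x) * R.eval x =
      (∫ x in (-1)..1, ω x * R.eval x) - ∫ x in (-1)..1, P.eval x * R.eval x := by
    intro R
    simp only [sub_mul]
    exact intervalIntegral.integral_sub (hintω R) (hintP R)
  have horth' : ∀ v : Polynomial ℝ, v.natDegree < p →
      ∫ x in (-1 : ℝ)..1, (ω x - P.eval x) * v.eval x = 0 := by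
    intro v hv
    rw [← neg_eq_zero, ← intervalIntegral.integral_neg, ← horth v hv]
    congr 1
    ext x
    ring
  set e : ℕ → ℝ := fun n => ∫ x in (-1)..1, (ω x - P.eval x) * (legendreP n).eval x with he
  have hlow : ∀ n < p, e n = 0 := fun n hn => horth' _ ((natDegree_legendreP_le n).trans_lt hn)
  have hhigh : ∀ n > p, |e n| ≤ (A * U) * ((n : ℝ) + 1) ^ (-(s + 1)) := by
    intro n hn
    have h1 := hA₁ n A hA1
    have h2 := hpair (legendreP n) (A * ((n : ℝ) + 1) ^ (-(s + 1))) h1.1 h1.2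
    rw [integral_eval_mul_legendreP_eq_zero (v := q) (by omega), sub_zero] at h2
    simp only [he]
    rw [hE, integral_eval_mul_legendreP_eq_zero (v := P) (by omega), sub_zero]
    exact h2.trans_eq (by ring)
  have hmid : |e p| ≤ (A * U) * ((p : ℝ) + 1) ^ (-(s + 1 / 2)) := by
    have h1 := hA₂ p A hA2
    have h2 := hpair (Polynomial.derivative (radauD p))
      (A * ((p : ℝ) + 1) ^ (-(s - 1 / 2))) h1.1 h1.2
    have h3 : ∫ x in (-1)..1, (ω x - P.eval x) * (Polynomial.derivative (radauD p)).eval x =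
        (2 * (p : ℝ) + 1) * e p := by
      obtain ⟨n, rfl⟩ : ∃ n, p = n + 1 := ⟨p - 1, by omega⟩
      have hv : (Polynomial.derivative (legendreP n) -
          Polynomial.derivative (legendreP (n + 1))).natDegree < n + 1 := by
        have d1 := Polynomial.natDegree_derivative_le (legendreP n)
        have d2 := Polynomial.natDegree_derivative_le (legendreP (n + 1))
        have d3 := natDegree_legendreP_le n
        have d4 := natDegree_legendreP_le (n + 1)
        refine Nat.lt_succ_of_le
          (Polynomial.natDegree_sub_le_of_le ?_ ?_ |>.trans (max_self n).le) <;> omega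
      have h4 : ∀ R : Polynomial ℝ,
          IntervalIntegrable (fun x => (ω x - P.eval x) * R.eval x) volume (-1) 1 := fun R => by
        simpa only [sub_mul] using (hintω R).sub (hintP R)
      rw [derivative_radauD_succ]
      simp only [Polynomial.eval_add, Polynomial.eval_mul, Polynomial.eval_C, mul_add]
      have h5 := horth' _ hv
      rw [intervalIntegral.integral_add _ (h4 _), h5, add_zero]
      · simp only [mul_left_comm (ω _ - _), intervalIntegral.integral_const_mul, he]
        push_cast
        ring
      · simpa only [mul_left_comm (ω _ - _)] using (h4 (legendreP (n + 1))).const_mul _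
    rw [hE, integral_eval_mul_derivative_radauD (by omega) hP, hP1, ← hq1,
      ← integral_eval_mul_derivative_radauD (by omega) (by omega : q.natDegree ≤ p)] at h3
    rw [h3, abs_mul, abs_of_pos (by positivity)] at h2
    have hp1 : (0 : ℝ) < (p : ℝ) + 1 := by positivity
    have h4 : ((p : ℝ) + 1) ^ (-(s - 1 / 2)) = ((p : ℝ) + 1) * ((p : ℝ) + 1) ^ (-(s + 1 / 2)) := by
      rw [show -(s - 1 / 2) = 1 + -(s + 1 / 2) by ring, Real.rpow_add hp1, Real.rpow_one]
    rw [h4] at h2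
    have h5 : ((p : ℝ) + 1) * |e p| ≤ (2 * (p : ℝ) + 1) * |e p| := by
      gcongr
      linarith [p.cast_nonneg (α := ℝ)]
    refine le_of_mul_le_mul_left (h5.trans (h2.trans_eq ?_)) hp1
    ring
  have hB := integral_sq_le_of_legendre_coeff (E := fun x => ω x - P.eval x)
    (hω.1.sub P.continuous.continuousOn) (sum_sq_le_of_coeff_decay hs hlow hmid hhigh)
  have hp0 : (0 : ℝ) < p := by exact_mod_cast (by omega : 0 < p)
  refine (Real.sqrt_le_sqrt hB).trans ?_
  have h1 : (A * U) ^ 2 * (1 + 1 / (2 * s)) * ((p : ℝ) + 1) ^ (-(2 * s)) =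
      (A * U * ((p : ℝ) + 1) ^ (-s)) ^ 2 * (1 + 1 / (2 * s)) := by
    have : ((p : ℝ) + 1) ^ (-(2 * s)) = (((p : ℝ) + 1) ^ (-s)) ^ 2 := by
      rw [← Real.rpow_natCast, ← Real.rpow_mul (by positivity)]
      congr 1
      push_cast
      ring
    rw [this]
    ring
  rw [h1, Real.sqrt_mul (sq_nonneg _), Real.sqrt_sq (by positivity)]
  have h2 : ((p : ℝ) + 1) ^ (-s) ≤ (p : ℝ) ^ (-s) :=
    Real.rpow_le_rpow_of_nonpos hp0 (by linarith) (by linarith)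
  calc A * U * ((p : ℝ) + 1) ^ (-s) * Real.sqrt (1 + 1 / (2 * s))
      ≤ A * U * (p : ℝ) ^ (-s) * Real.sqrt (1 + 1 / (2 * s)) := by gcongr
    _ = _ := by ring
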